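/- For every δ > 0 there exist a > 1/2, ε ∈ (0,1), c > 0 and N₀ such that for all integers N ≥ N₀ the function w_N(t,x) := √(2π/log N) · (2π)^{−2} ∫_{1<|ξ|<e^{−a}N} |ξ|^{−2} e^{i(−t|ξ|² + ξ·x)} dξ (a solution of the free Schrödinger equation i∂_t w + Δw = 0 on ℝ^{1+2}) satisfies: (i) ‖∇w_N(0,·)‖²_{L²(ℝ²)} + ‖w_N(0,·)‖²_{L²(ℝ²)} < 1; (ii) ‖∇w_N(0,·)‖²_{L²} + ∫_{ℝ²} 2F(w_N(0,x)) dx ≤ 1 + δ; and (iii) for all p, q ∈ [1,∞] with 1/p + 1/q = 3/2, ( ∫_{ε²/(4N²)}^{ε²/(2N²)} ‖∇(f∘w_N)(t,·)‖_{L^q({ε/(4N) ≤ |x| ≤ ε/(2N)})}^p dt )^{1/p} ≥ c √(log N). -/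

import Mathlib

open MeasureTheory Real Classical
open scoped ENNReal RealInnerProductSpace

noncomputable section

/-- The plane `ℝ²`. -/
abbrev Plane := EuclideanSpace ℝ (Fin 2)

/-- Pointwise norm of the (full) gradient of `u`. -/
def gradNorm (u : Plane → ℝ) (x : Plane) : ℝ := ‖fderiv ℝ u x‖

/-- The `L^p` norm for a real (finite) exponent `p`. -/
def LpNorm (p : ℝ) (u : Plane → ℝ) : ℝ := (∫ x : Plane, |u x| ^ p) ^ (1 / p)

/-- The sup (`L^∞`) norm. -/
def supNorm (u : Plane → ℝ) : ℝ := ⨆ x : Plane, |u x|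

/-- The homogeneous Hölder seminorm `[u]_α`. -/
def holderSemi (α : ℝ) (u : Plane → ℝ) : ℝ :=
  ⨆ p : Plane × Plane,
    if p.1 = p.2 then 0 else |u p.1 - u p.2| / ‖p.1 - p.2‖ ^ α

/-- The Hölder norm `‖u‖_{C^α} = sup |u| + [u]_α`. -/
def holderNorm (α : ℝ) (u : Plane → ℝ) : ℝ := supNorm u + holderSemi α u

/-- `u` is `α`-Hölder continuous. -/
def IsHolder (α : ℝ) (u : Plane → ℝ) : Prop :=
  ∃ C : ℝ, 0 ≤ C ∧ ∀ x y : Plane, |u x - u y| ≤ C * ‖x - y‖ ^ α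

/-- The squared `H¹` norm `‖∇u‖_{L²}² + ‖u‖_{L²}²`. -/
def H1Sq (u : Plane → ℝ) : ℝ :=
  (∫ x : Plane, gradNorm u x ^ 2) + ∫ x : Plane, u x ^ 2

/-- The squared local `H¹` norm `‖u‖_{H¹[R]}²`. -/
def H1locSq (R : ℝ) (u : Plane → ℝ) : ℝ :=
  ⨆ c : Plane, ∫ x in Metric.closedBall c R, (gradNorm u x ^ 2 + u x ^ 2)

/-- Membership in `H¹(ℝ²)` (with classical derivatives). -/
def MemH1 (u : Plane → ℝ) : Prop :=
  Differentiable ℝ u ∧ Integrable (fun x => u x ^ 2) ∧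
    Integrable (fun x => gradNorm u x ^ 2)

/-- The nonlinearity `f(u) = (e^{4π u²} - 1 - 4π u²) u`. -/
def f (s : ℝ) : ℝ := (Real.exp (4 * π * s ^ 2) - 1 - 4 * π * s ^ 2) * s

/-- The potential `F(u) = (1/8π)(e^{4π u²} - 1 - 4π u² - 8π² u⁴)`. -/
def F (s : ℝ) : ℝ :=
  (8 * π)⁻¹ * (Real.exp (4 * π * s ^ 2) - 1 - 4 * π * s ^ 2 - 8 * π ^ 2 * s ^ 4)

/-- Pointwise norm of the gradient of a complex-valued function. -/
def gradNormC (u : Plane → ℂ) (x : Plane) : ℝ := ‖fderiv ℝ u x‖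

/-- The nonlinearity `f(u) = (e^{4π|u|²} - 1 - 4π|u|²) u` for complex `u`. -/
def fC (z : ℂ) : ℂ :=
  ((Real.exp (4 * π * ‖z‖ ^ 2) - 1 - 4 * π * ‖z‖ ^ 2 : ℝ) : ℂ) * z

/-- The potential `F(u)` for complex `u`. -/
def FC (z : ℂ) : ℝ :=
  (8 * π)⁻¹ *
    (Real.exp (4 * π * ‖z‖ ^ 2) - 1 - 4 * π * ‖z‖ ^ 2 - 8 * π ^ 2 * ‖z‖ ^ 4)

/-- `u` is `α`-Hölder continuous (complex-valued version). -/
def IsHolderC (α : ℝ) (u : Plane → ℂ) : Prop :=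
  ∃ C : ℝ, 0 ≤ C ∧ ∀ x y : Plane, ‖u x - u y‖ ≤ C * ‖x - y‖ ^ α

/-- The Hölder norm `‖u‖_{C^α}` (complex-valued version). -/
def holderNormC (α : ℝ) (u : Plane → ℂ) : ℝ :=
  (⨆ x : Plane, ‖u x‖) +
    ⨆ p : Plane × Plane,
      if p.1 = p.2 then 0 else ‖u p.1 - u p.2‖ / ‖p.1 - p.2‖ ^ α

/-- The frequency annulus `1 < |ξ| < e^{-a} N`. -/
def freqSet (a N : ℝ) : Set Plane := {ξ | 1 < ‖ξ‖ ∧ ‖ξ‖ < Real.exp (-a) * N}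

/-- The concentrating family of radial free Schrödinger solutions `w_N`. -/
def wS (a : ℝ) (N : ℕ) (t : ℝ) (x : Plane) : ℂ :=
  (Real.sqrt (2 * π / Real.log N) * (2 * π) ^ (-2 : ℤ) : ℝ) •
    ∫ ξ in freqSet a N,
      (‖ξ‖ ^ (-2 : ℤ) : ℝ) •
        Complex.exp (Complex.I * Complex.ofReal (-t * ‖ξ‖ ^ 2 + ⟪ξ, x⟫))

open scoped FourierTransform ContDiff SchwartzMap in
/-- The `L²` Fourier transform of an integrable function is its Fourier integral. -/
theorem fourier_toLp_ae_eq {g : Plane → ℂ} (h1 : Integrable g) (h2 : MemLp g 2) :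
    (𝓕 (h2.toLp g) : Lp ℂ 2 (volume : Measure Plane)) =ᵐ[volume] 𝓕 g := by
  have hc : Continuous (𝓕 g) :=
    VectorFourier.fourierIntegral_continuous Real.continuous_fourierChar
      (by exact continuous_inner) h1
  apply ae_eq_of_integral_contDiff_smul_eq
  · exact (Lp.memLp _).locallyIntegrable (by norm_num)
  · exact hc.locallyIntegrable
  · intro φ φs φc
    have hg₁ : HasCompactSupport (Complex.ofRealCLM ∘ φ) := φc.comp_left rfl
    have hg₂ : ContDiff ℝ ∞ (Complex.ofRealCLM ∘ φ) := by fun_prop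
    set ψ : 𝓢(Plane, ℂ) := hg₁.toSchwartzMap hg₂ with hψ
    have hψe : ∀ x, ψ x = (φ x : ℂ) := fun x => by simp [hψ]
    have key := congrArg (fun T => T ψ) (Lp.fourier_toTemperedDistribution_eq (h2.toLp g))
    simp only [TemperedDistribution.fourier_apply, Lp.toTemperedDistribution_apply] at key
    calc ∫ x, φ x • (𝓕 (h2.toLp g) : Lp ℂ 2 (volume : Measure Plane)) x
        = ∫ x, ψ x • (𝓕 (h2.toLp g) : Lp ℂ 2 (volume : Measure Plane)) x := by
          simp only [hψe]; simp
      _ = ∫ x, (𝓕 ψ) x • (h2.toLp g) x := key.symm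
      _ = ∫ x, (𝓕 ψ) x • g x := by
          apply integral_congr_ae
          filter_upwards [h2.coeFn_toLp] with x hx
          rw [hx]
      _ = ∫ x, ψ x • 𝓕 g x := by
          have := VectorFourier.integral_fourierIntegral_smul_eq_flip (μ := volume) (ν := volume)
            (e := Real.fourierChar) (L := innerₗ Plane) (f := ψ) (g := g)
            Real.continuous_fourierChar (by exact continuous_inner) ψ.integrable h1
          rw [flip_innerₗ] at this
          rw [SchwartzMap.fourier_coe]
          exact this
      _ = ∫ x, φ x • 𝓕 g x := by simp only [hψe]; simp

open scoped FourierTransform in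
theorem memLp_fourier {g : Plane → ℂ} (h1 : Integrable g) (h2 : MemLp g 2) :
    MemLp (𝓕 g) 2 volume ∧ ∫ x, ‖𝓕 g x‖ ^ 2 = ∫ ξ, ‖g ξ‖ ^ 2 := by
  have hae := fourier_toLp_ae_eq h1 h2
  have hm : MemLp (𝓕 g) 2 volume := (Lp.memLp _).ae_eq hae
  refine ⟨hm, ?_⟩
  have hn := Lp.norm_fourier_eq (h2.toLp g)
  have e1 : ∀ {u : Plane → ℂ}, MemLp u 2 volume →
      ∫ x, ‖u x‖ ^ 2 = (eLpNorm u 2 volume).toReal ^ 2 := by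
    intro u hu
    rw [hu.eLpNorm_eq_integral_rpow_norm (by norm_num) (by norm_num)]
    rw [ENNReal.toReal_ofReal (by positivity), ← Real.rpow_natCast, ← Real.rpow_mul (by positivity)]
    simp
  rw [e1 hm, e1 h2, ← Lp.norm_toLp g h2, ← hn, Lp.norm_def, eLpNorm_congr_ae hae]

/-- Plancherel's theorem with the kernel `e^{i ξ·x}`. -/
theorem plancherel_exp {g : Plane → ℂ} (h1 : Integrable g) (h2 : MemLp g 2) :
    Integrable (fun x : Plane => ‖∫ ξ, Complex.exp (Complex.I * (⟪ξ, x⟫ : ℝ)) * g ξ‖ ^ 2) ∧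
    ∫ x : Plane, ‖∫ ξ, Complex.exp (Complex.I * (⟪ξ, x⟫ : ℝ)) * g ξ‖ ^ 2 =
      (2 * π) ^ 2 * ∫ ξ, ‖g ξ‖ ^ 2 := by
  obtain ⟨hm, hi⟩ := memLp_fourier h1 h2
  have hk : ∀ x : Plane, ∫ ξ, Complex.exp (Complex.I * (⟪ξ, x⟫ : ℝ)) * g ξ =
      FourierTransform.fourier g ((-(2 * π)⁻¹ : ℝ) • x) := by
    intro x
    rw [Real.fourier_eq']
    refine integral_congr_ae (Filter.Eventually.of_forall fun ξ => ?_)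
    simp only [smul_eq_mul, inner_smul_right]
    congr 2
    have : (π : ℂ) ≠ 0 := by exact_mod_cast Real.pi_ne_zero
    push_cast
    field_simp
  simp only [hk]
  have hpi := Real.pi_pos
  constructor
  · have := (memLp_two_iff_integrable_sq_norm hm.1).1 hm
    exact this.comp_smul (by simp [Real.pi_ne_zero])
  · rw [Measure.integral_comp_smul volume
      (fun y => ‖FourierTransform.fourier g y‖ ^ 2), hi]
    simp only [finrank_euclideanSpace, Fintype.card_fin, smul_eq_mul]
    rw [neg_sq, abs_of_nonneg (by positivity)]
    simp only [inv_pow, inv_inv]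

/-- The plane is isometric to `ℂ`, with a given direction sent to the real axis. -/
theorem exists_linearIsometryEquiv_inner_eq (x : Plane) :
    ∃ L : ℂ ≃ₗᵢ[ℝ] Plane, ∀ z : ℂ, ⟪L z, x⟫ = ‖x‖ * z.re := by
  set B : ℂ ≃ₗᵢ[ℝ] Plane := Complex.orthonormalBasisOneI.repr
  set z₀ : ℂ := B.symm x with hz
  have hn : ‖z₀‖ = ‖x‖ := B.symm.norm_map x
  obtain ⟨u, hu⟩ : ∃ u : Circle, z₀ = (‖z₀‖ : ℂ) * u := by
    refine ⟨Circle.exp z₀.arg, ?_⟩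
    rw [Circle.coe_exp, Complex.norm_mul_exp_arg_mul_I]
  refine ⟨(rotation u).trans B, fun z => ?_⟩
  have hx : x = B z₀ := by simp [hz]
  have h1 : ⟪((rotation u).trans B) z, x⟫ = ⟪(u : ℂ) * z, z₀⟫ := by
    conv_lhs => rw [hx]
    rw [LinearIsometryEquiv.trans_apply, B.inner_map_map, rotation_apply]
  rw [h1, hu, hn, Complex.inner]
  have h2 : ((‖x‖ : ℂ) * u) * (starRingEnd ℂ) ((u : ℂ) * z) =
      (‖x‖ : ℂ) * (((u : ℂ) * (starRingEnd ℂ) (u : ℂ)) * (starRingEnd ℂ) z) := by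
    rw [map_mul]; ring
  have h3 : (u : ℂ) * (starRingEnd ℂ) (u : ℂ) = 1 := by
    rw [Complex.mul_conj]; simp
  rw [h2, h3, one_mul]
  simp

/-- Polar coordinates for functions of `‖ξ‖` and `⟪ξ, x⟫`. -/
theorem integral_norm_inner_eq_polar {E : Type*} [NormedAddCommGroup E] [NormedSpace ℝ E]
    (G : ℝ → ℝ → E) (x : Plane) :
    ∫ ξ : Plane, G ‖ξ‖ ⟪ξ, x⟫ =
      ∫ p in Set.Ioi (0 : ℝ) ×ˢ Set.Ioo (-π) π, p.1 • G p.1 (p.1 * (‖x‖ * Real.cos p.2)) := by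
  obtain ⟨L, hL⟩ := exists_linearIsometryEquiv_inner_eq x
  rw [← L.measurePreserving.integral_comp L.toHomeomorph.measurableEmbedding,
    ← Complex.integral_comp_polarCoord_symm]
  refine setIntegral_congr_fun (measurableSet_Ioi.prod measurableSet_Ioo) ?_
  rintro ⟨r, θ⟩ ⟨hr, -⟩
  have hr' : (0 : ℝ) < r := hr
  simp only [LinearIsometryEquiv.norm_map, hL, Complex.norm_polarCoord_symm, abs_of_pos hr']
  congr 2
  simp [Complex.cos_ofReal_re]
  ring

/-- The open annulus `{1 < ‖ξ‖ < R}`. -/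
def annulus (R : ℝ) : Set Plane := {ξ | 1 < ‖ξ‖ ∧ ‖ξ‖ < R}

theorem measurableSet_annulus (R : ℝ) : MeasurableSet (annulus R) :=
  (measurableSet_lt measurable_const measurable_norm).inter
    (measurableSet_lt measurable_norm measurable_const)

theorem annulus_subset_ball (R : ℝ) : annulus R ⊆ Metric.ball 0 R := fun ξ h => by
  simpa using h.2

theorem volume_annulus_lt_top (R : ℝ) : volume (annulus R) < ∞ :=
  (measure_mono (annulus_subset_ball R)).trans_lt measure_ball_lt_top

theorem integrableOn_annulus {E : Type*} [NormedAddCommGroup E] {R C : ℝ}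
    {g : Plane → E} (hg : AEStronglyMeasurable g (volume.restrict (annulus R)))
    (hC : ∀ ξ ∈ annulus R, ‖g ξ‖ ≤ C) :
    IntegrableOn g (annulus R) :=
  IntegrableOn.of_bound (volume_annulus_lt_top R) hg C
    ((ae_restrict_iff' (measurableSet_annulus R)).2 (Filter.Eventually.of_forall hC))

/-- Iterated polar coordinates on the annulus, with the angular integral outside. -/
theorem setIntegral_annulus_eq_polar {E : Type*} [NormedAddCommGroup E] [NormedSpace ℝ E]
    (G : ℝ → ℝ → E) (hG : ContinuousOn (Function.uncurry G) (Set.Ici 1 ×ˢ Set.univ))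
    (x : Plane) {R : ℝ} (hR : 1 ≤ R) :
    ∫ ξ in annulus R, G ‖ξ‖ ⟪ξ, x⟫ =
      ∫ θ in (-π)..π, ∫ r in (1 : ℝ)..R, r • G r (r * (‖x‖ * Real.cos θ)) := by
  have hS : ∀ ξ : Plane, (annulus R).indicator (fun ξ => G ‖ξ‖ ⟪ξ, x⟫) ξ =
      (fun r s => (Set.Ioo 1 R).indicator (fun r => G r s) r) ‖ξ‖ ⟪ξ, x⟫ := by
    intro ξ
    simp only [Set.indicator_apply, annulus, Set.mem_ofPred_eq, Set.mem_Ioo]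
  rw [← integral_indicator (measurableSet_annulus R), integral_congr_ae (.of_forall hS),
    integral_norm_inner_eq_polar (fun r s => (Set.Ioo 1 R).indicator (fun r => G r s) r)]
  have hc : ContinuousOn (fun p : ℝ × ℝ => p.1 • G p.1 (p.1 * (‖x‖ * Real.cos p.2)))
      (Set.Icc 1 R ×ˢ Set.Icc (-π) π) := by
    refine ContinuousOn.smul (by fun_prop) ?_
    refine hG.comp (f := fun p : ℝ × ℝ => (p.1, p.1 * (‖x‖ * Real.cos p.2))) (by fun_prop) ?_
    rintro ⟨r, θ⟩ h
    exact ⟨h.1.1, trivial⟩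
  have hintegr : IntegrableOn (fun p : ℝ × ℝ => p.1 • G p.1 (p.1 * (‖x‖ * Real.cos p.2)))
      (Set.Ioo 1 R ×ˢ Set.Ioo (-π) π) :=
    (hc.integrableOn_compact (isCompact_Icc.prod isCompact_Icc)).mono_set
      (Set.prod_mono Set.Ioo_subset_Icc_self Set.Ioo_subset_Icc_self)
  have h1 : ∀ p : ℝ × ℝ, p.1 • (Set.Ioo 1 R).indicator
        (fun r => G r (p.1 * (‖x‖ * Real.cos p.2))) p.1 =
      (Set.Ioo (1 : ℝ) R ×ˢ (Set.univ : Set ℝ)).indicator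
        (fun p => p.1 • G p.1 (p.1 * (‖x‖ * Real.cos p.2))) p := by
    intro p
    by_cases hp : p.1 ∈ Set.Ioo 1 R <;> simp [hp]
  have hsub : Set.Ioo (1 : ℝ) R ⊆ Set.Ioi 0 := fun r hr => lt_trans one_pos hr.1
  simp only [h1]
  rw [setIntegral_indicator (measurableSet_Ioo.prod MeasurableSet.univ), Set.prod_inter_prod,
    Set.inter_univ, Set.inter_eq_right.2 hsub]
  rw [Measure.volume_eq_prod] at hintegr ⊢
  have hs := hintegr.swap
  simp only [Function.comp_def] at hs
  rw [← setIntegral_prod_swap, setIntegral_prod _ hs,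
    intervalIntegral.integral_of_le (by linarith [Real.pi_pos]), integral_Ioc_eq_integral_Ioo]
  simp only [intervalIntegral.integral_of_le hR, integral_Ioc_eq_integral_Ioo, Prod.swap_prod_mk]

theorem integral_annulus_norm_zpow_neg_two {R : ℝ} (hR : 1 ≤ R) :
    ∫ ξ in annulus R, ‖ξ‖ ^ (-2 : ℤ) = 2 * π * Real.log R := by
  have h := setIntegral_annulus_eq_polar (fun r _ => r ^ (-2 : ℤ))
    (by
      refine ContinuousOn.zpow₀ (by fun_prop) _ fun p hp => Or.inl ?_
      exact (lt_of_lt_of_le one_pos hp.1).ne') (0 : Plane) hR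
  rw [h]
  have h2 : ∫ r in (1 : ℝ)..R, r • r ^ (-2 : ℤ) = Real.log R := by
    rw [← div_one R, ← integral_inv_of_pos one_pos (by linarith)]
    simp only [div_one]
    refine intervalIntegral.integral_congr fun r hr => ?_
    rw [Set.uIcc_of_le hR] at hr
    have : r ≠ 0 := (lt_of_lt_of_le one_pos hr.1).ne'
    simp only [smul_eq_mul, zpow_neg]
    field_simp
  rw [h2, intervalIntegral.integral_const, smul_eq_mul]
  ring

theorem integral_annulus_norm_zpow_neg_two_sq_le {R : ℝ} (hR : 1 ≤ R) :
    ∫ ξ in annulus R, (‖ξ‖ ^ (-2 : ℤ)) ^ 2 ≤ π := by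
  have h := setIntegral_annulus_eq_polar (fun r _ => (r ^ (-2 : ℤ)) ^ 2)
    (by
      refine ContinuousOn.pow (ContinuousOn.zpow₀ (by fun_prop) _ fun p hp => Or.inl ?_) _
      exact (lt_of_lt_of_le one_pos hp.1).ne') (0 : Plane) hR
  rw [h]
  have h2 : ∫ r in (1 : ℝ)..R, r • (r ^ (-2 : ℤ)) ^ 2 = (1 - R ^ (-2 : ℤ)) / 2 := by
    have : ∫ r in (1 : ℝ)..R, r • (r ^ (-2 : ℤ)) ^ 2 = ∫ r in (1 : ℝ)..R, r ^ (-3 : ℤ) := by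
      refine intervalIntegral.integral_congr fun r hr => ?_
      rw [Set.uIcc_of_le hR] at hr
      have : r ≠ 0 := (lt_of_lt_of_le one_pos hr.1).ne'
      simp only [smul_eq_mul, zpow_neg]
      field_simp
    rw [this, integral_zpow]
    · norm_num
      ring
    · right
      refine ⟨by norm_num, ?_⟩
      rw [Set.uIcc_of_le hR]
      exact fun h => absurd h.1 (by norm_num)
  rw [h2, intervalIntegral.integral_const, smul_eq_mul]
  have : 0 ≤ R ^ (-2 : ℤ) := by positivity
  nlinarith [Real.pi_pos]

theorem integral_annulus_one_le {R : ℝ} (hR : 1 ≤ R) :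
    ∫ _ξ in annulus R, (1 : ℝ) ≤ π * R ^ 2 := by
  have h := setIntegral_annulus_eq_polar (fun _ _ => (1 : ℝ)) (by fun_prop) (0 : Plane) hR
  rw [h]
  simp only [smul_eq_mul, mul_one, integral_id, intervalIntegral.integral_const]
  nlinarith [Real.pi_pos]

theorem integral_annulus_inner_sq {R : ℝ} (hR : 1 ≤ R) (e : Plane) :
    ∫ ξ in annulus R, ‖ξ‖ ^ (-2 : ℤ) * ⟪ξ, e⟫ ^ 2 = π * ‖e‖ ^ 2 * (R ^ 2 - 1) / 2 := by
  have h := setIntegral_annulus_eq_polar (fun r s => r ^ (-2 : ℤ) * s ^ 2)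
    (by
      refine ContinuousOn.mul (ContinuousOn.zpow₀ (by fun_prop) _ fun p hp => Or.inl ?_)
        (by fun_prop)
      exact (lt_of_lt_of_le one_pos hp.1).ne') e hR
  rw [h]
  have h2 : ∀ θ : ℝ, ∫ r in (1 : ℝ)..R, r • (r ^ (-2 : ℤ) * (r * (‖e‖ * Real.cos θ)) ^ 2) =
      (‖e‖ ^ 2 * (R ^ 2 - 1) / 2) * Real.cos θ ^ 2 := by
    intro θ
    have : ∫ r in (1 : ℝ)..R, r • (r ^ (-2 : ℤ) * (r * (‖e‖ * Real.cos θ)) ^ 2) =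
        ∫ r in (1 : ℝ)..R, r * (‖e‖ * Real.cos θ) ^ 2 := by
      refine intervalIntegral.integral_congr fun r hr => ?_
      rw [Set.uIcc_of_le hR] at hr
      have : r ≠ 0 := (lt_of_lt_of_le one_pos hr.1).ne'
      simp only [smul_eq_mul, zpow_neg]
      field_simp
    rw [this, intervalIntegral.integral_mul_const, integral_id]
    ring
  simp only [h2]
  rw [intervalIntegral.integral_const_mul, integral_cos_sq]
  simp
  ring

theorem intervalIntegrable_inv_mul_cexp {M R : ℝ} (hM : 0 < M) (hMR : M ≤ R) (k : ℝ) :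
    IntervalIntegrable (fun r : ℝ => (r : ℂ)⁻¹ * Complex.exp (Complex.I * (r * k : ℝ)))
      volume M R := by
  refine ContinuousOn.intervalIntegrable ?_
  rw [Set.uIcc_of_le hMR]
  refine ContinuousOn.mul (ContinuousOn.inv₀ (by fun_prop) fun r hr => ?_) (by fun_prop)
  exact_mod_cast (lt_of_lt_of_le hM hr.1).ne'

theorem norm_integral_inv_mul_cexp_le {M R k : ℝ} (hM : 0 < M) (hMR : M ≤ R) (hk : k ≠ 0) :
    ‖∫ r in M..R, (r : ℂ)⁻¹ * Complex.exp (Complex.I * (r * k : ℝ))‖ ≤ 2 / (|k| * M) := by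
  have hkC : (k : ℂ) ≠ 0 := by exact_mod_cast hk
  have hR : 0 < R := hM.trans_le hMR
  have hpos : ∀ r ∈ Set.uIcc M R, (r : ℂ) ≠ 0 := fun r hr => by
    rw [Set.uIcc_of_le hMR] at hr
    exact_mod_cast (lt_of_lt_of_le hM hr.1).ne'
  set v : ℝ → ℂ := fun r => Complex.exp (Complex.I * (r * k : ℝ)) / (Complex.I * k)
  have hv : ∀ r, HasDerivAt v (Complex.exp (Complex.I * (r * k : ℝ))) r := by
    intro r
    have h1 : HasDerivAt (fun r : ℝ => Complex.I * ((r * k : ℝ) : ℂ)) (Complex.I * k) r := by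
      have := ((hasDerivAt_id r).mul_const k).ofReal_comp.const_mul Complex.I
      simpa using this
    have h2 := h1.cexp.div_const (Complex.I * k)
    rwa [mul_div_assoc, div_self (mul_ne_zero Complex.I_ne_zero hkC), mul_one] at h2
  have hvn : ∀ r, ‖v r‖ = 1 / |k| := by
    intro r
    simp only [v, norm_div, norm_mul, Complex.norm_I, one_mul, Complex.norm_real, Real.norm_eq_abs]
    rw [mul_comm Complex.I, Complex.norm_exp_ofReal_mul_I]
  have hu : ∀ r ∈ Set.uIcc M R, HasDerivAt (fun r : ℝ => (r : ℂ)⁻¹) (-((r : ℂ) ^ 2)⁻¹) r := by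
    intro r hr
    have h := (Complex.ofRealCLM.hasDerivAt (x := r)).fun_inv (hpos r hr)
    simp only [Complex.ofRealCLM_apply, Complex.ofReal_one, neg_div, one_div] at h
    exact h
  have hcont : ContinuousOn (fun r : ℝ => -((r : ℂ) ^ 2)⁻¹) (Set.uIcc M R) :=
    (ContinuousOn.inv₀ (by fun_prop) fun r hr => pow_ne_zero 2 (hpos r hr)).neg
  rw [intervalIntegral.integral_mul_deriv_eq_deriv_mul hu (fun r _ => hv r)
    hcont.intervalIntegrable (Continuous.intervalIntegrable (by fun_prop) _ _)]
  have hb : ‖∫ r in M..R, -((r : ℂ) ^ 2)⁻¹ * v r‖ ≤ (1 / |k|) * (1 / M - 1 / R) := by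
    have e : ∫ r in M..R, (1 / |k|) * r ^ (-2 : ℤ) = (1 / |k|) * (1 / M - 1 / R) := by
      rw [intervalIntegral.integral_const_mul, integral_zpow]
      · norm_num
        left; ring
      · right
        refine ⟨by norm_num, fun h => ?_⟩
        exact hpos 0 h (by simp)
    rw [← e]
    refine intervalIntegral.norm_integral_le_of_norm_le hMR (.of_forall fun r _ => ?_) ?_
    · rw [norm_mul, hvn, norm_neg, norm_inv, norm_pow, Complex.norm_real, mul_comm,
        Real.norm_eq_abs, sq_abs, zpow_neg]
      norm_cast
    · refine ContinuousOn.intervalIntegrable ?_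
      refine ContinuousOn.mul (by fun_prop) (ContinuousOn.zpow₀ (by fun_prop) _ fun r hr => ?_)
      exact Or.inl (by exact_mod_cast hpos r hr)
  refine (norm_sub_le _ _).trans ((add_le_add (norm_sub_le _ _) hb).trans (le_of_eq ?_))
  rw [norm_mul, norm_mul, hvn, hvn, norm_inv, norm_inv, Complex.norm_real, Complex.norm_real,
    Real.norm_of_nonneg hM.le, Real.norm_of_nonneg hR.le]
  have : |k| ≠ 0 := abs_ne_zero.2 hk
  field_simp
  ring

theorem norm_integral_inv_mul_cexp_le_log {M R : ℝ} (hM : 0 < M) (hMR : M ≤ R) (k : ℝ) :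
    ‖∫ r in M..R, (r : ℂ)⁻¹ * Complex.exp (Complex.I * (r * k : ℝ))‖ ≤ Real.log (R / M) := by
  rw [← integral_inv_of_pos hM (hM.trans_le hMR)]
  refine intervalIntegral.norm_integral_le_of_norm_le hMR (.of_forall fun r hr => ?_) ?_
  · rw [norm_mul, mul_comm Complex.I, Complex.norm_exp_ofReal_mul_I, mul_one, norm_inv,
      Complex.norm_real, Real.norm_of_nonneg (hM.trans hr.1).le]
  · refine ContinuousOn.intervalIntegrable (ContinuousOn.inv₀ (by fun_prop) fun r hr => ?_)
    rw [Set.uIcc_of_le hMR] at hr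
    exact (lt_of_lt_of_le hM hr.1).ne'

theorem norm_radial_integral_le {R k : ℝ} (hR : 1 ≤ R) (hk : k ≠ 0) :
    ‖∫ r in (1 : ℝ)..R, (r : ℂ)⁻¹ * Complex.exp (Complex.I * (r * k : ℝ))‖ ≤
      max 0 (-Real.log k) + 2 := by
  have hk' : 0 < |k| := abs_pos.2 hk
  rcases le_or_gt 1 |k| with h1 | h1
  · have h := norm_integral_inv_mul_cexp_le one_pos hR hk
    have : 2 / (|k| * 1) ≤ 2 := by
      rw [mul_one, div_le_iff₀ hk']; linarith
    linarith [le_max_left 0 (-Real.log k)]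
  · have hM1 : 1 ≤ |k|⁻¹ := (one_le_inv₀ hk').2 h1.le
    have hlog : Real.log |k|⁻¹ = -Real.log k := by rw [Real.log_inv, Real.log_abs]
    rcases le_or_gt R |k|⁻¹ with h2 | h2
    · have h := norm_integral_inv_mul_cexp_le_log one_pos hR k
      rw [div_one] at h
      have := Real.log_le_log (by linarith) h2
      linarith [le_max_right 0 (-Real.log k)]
    · rw [← intervalIntegral.integral_add_adjacent_intervals
        (intervalIntegrable_inv_mul_cexp one_pos hM1 k)
        (intervalIntegrable_inv_mul_cexp (by positivity) h2.le k)]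
      have h3 := norm_integral_inv_mul_cexp_le_log one_pos hM1 k
      have h4 := norm_integral_inv_mul_cexp_le (inv_pos.2 hk') h2.le hk
      rw [div_one, hlog] at h3
      rw [mul_inv_cancel₀ hk'.ne', div_one] at h4
      refine (norm_add_le _ _).trans ?_
      linarith [le_max_right 0 (-Real.log k)]

/-- Logarithmic bound for the profile `∫_{1 < |ξ| < R} |ξ|⁻² e^{i ξ·x} dξ`. -/
theorem exists_norm_profile_le :
    ∃ C : ℝ, 0 ≤ C ∧ ∀ R : ℝ, 1 ≤ R → ∀ x : Plane, x ≠ 0 →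
      ‖∫ ξ in annulus R, (‖ξ‖ ^ (-2 : ℤ) : ℝ) • Complex.exp (Complex.I * (⟪ξ, x⟫ : ℝ))‖ ≤
        2 * π * (max 0 (-Real.log ‖x‖) + C) := by
  have hπ := Real.pi_pos
  have hintegr : IntervalIntegrable (fun θ => -Real.log (Real.cos θ)) volume (-π) π :=
    intervalIntegrable_log_cos.neg
  have hcos : ∀ θ : ℝ, 0 ≤ -Real.log (Real.cos θ) := fun θ => by
    rw [← Real.log_abs]
    exact neg_nonneg.2 (Real.log_nonpos (abs_nonneg _) (Real.abs_cos_le_one θ))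
  set c := ∫ θ in (-π)..π, -Real.log (Real.cos θ)
  have hc : 0 ≤ c := intervalIntegral.integral_nonneg (by linarith) fun θ _ => hcos θ
  refine ⟨c / (2 * π) + 2, by positivity, fun R hR x hx => ?_⟩
  have hs : 0 < ‖x‖ := norm_pos_iff.2 hx
  have h := setIntegral_annulus_eq_polar
    (fun r s => (r ^ (-2 : ℤ) : ℝ) • Complex.exp (Complex.I * (s : ℝ)))
    (by
      have hz : ContinuousOn (fun p : ℝ × ℝ => p.1 ^ (-2 : ℤ)) (Set.Ici 1 ×ˢ Set.univ) :=
        ContinuousOn.zpow₀ (by fun_prop) _ fun p hp => Or.inl (lt_of_lt_of_le one_pos hp.1).ne'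
      exact hz.smul (g := fun p : ℝ × ℝ => Complex.exp (Complex.I * (p.2 : ℝ))) (by fun_prop)) x hR
  rw [h]
  have hin : ∀ θ : ℝ, ∫ r in (1 : ℝ)..R, r • ((r ^ (-2 : ℤ) : ℝ) •
      Complex.exp (Complex.I * (r * (‖x‖ * Real.cos θ) : ℝ))) =
      ∫ r in (1 : ℝ)..R, (r : ℂ)⁻¹ *
        Complex.exp (Complex.I * (r * (‖x‖ * Real.cos θ) : ℝ)) := by
    intro θ
    refine intervalIntegral.integral_congr fun r hr => ?_
    rw [Set.uIcc_of_le hR] at hr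
    have hr0 : r ≠ 0 := (lt_of_lt_of_le one_pos hr.1).ne'
    have : r * r ^ (-2 : ℤ) = r⁻¹ := by
      rw [zpow_neg]; field_simp
    rw [← smul_assoc, smul_eq_mul, this, Complex.real_smul, Complex.ofReal_inv]
  simp only [hin]
  have hnull : ∀ᵐ θ : ℝ, Real.cos θ ≠ 0 := by
    have : {θ : ℝ | ¬ Real.cos θ ≠ 0} ⊆ Set.range fun n : ℤ => (2 * (n : ℝ) + 1) * π / 2 := by
      intro θ hθ
      obtain ⟨n, hn⟩ := Real.cos_eq_zero_iff.1 (not_not.1 hθ)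
      exact ⟨n, hn.symm⟩
    exact measure_mono_null this ((Set.countable_range _).measure_zero _)
  have hI : IntervalIntegrable
      (fun θ => -Real.log (Real.cos θ) + (max 0 (-Real.log ‖x‖) + 2)) volume (-π) π :=
    hintegr.add intervalIntegrable_const
  refine (intervalIntegral.norm_integral_le_of_norm_le (by linarith) ?_ hI).trans (le_of_eq ?_)
  · filter_upwards [hnull] with θ hθ _
    refine (norm_radial_integral_le hR (mul_ne_zero hs.ne' hθ)).trans ?_
    rw [Real.log_mul hs.ne' hθ]
    have := hcos θ
    have h1 := le_max_left 0 (-Real.log ‖x‖)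
    have h2 := le_max_right 0 (-Real.log ‖x‖)
    have : max 0 (-(Real.log ‖x‖ + Real.log (Real.cos θ))) ≤
      -Real.log (Real.cos θ) + max 0 (-Real.log ‖x‖) := max_le (by linarith) (by linarith)
    linarith
  · rw [intervalIntegral.integral_add hintegr intervalIntegrable_const,
      intervalIntegral.integral_const, smul_eq_mul]
    field_simp
    ring

/-- The unnormalised profile of `wS`. -/
def profile (R t : ℝ) (x : Plane) : ℂ :=
  ∫ ξ in annulus R, (‖ξ‖ ^ (-2 : ℤ) : ℝ) •
    Complex.exp (Complex.I * Complex.ofReal (-t * ‖ξ‖ ^ 2 + ⟪ξ, x⟫))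

/-- The derivative of `profile R t` at `x` in the direction `e`. -/
def profileDeriv (R t : ℝ) (x e : Plane) : ℂ :=
  ∫ ξ in annulus R, (‖ξ‖ ^ (-2 : ℤ) : ℝ) • ((Complex.I * (⟪ξ, e⟫ : ℝ)) *
    Complex.exp (Complex.I * Complex.ofReal (-t * ‖ξ‖ ^ 2 + ⟪ξ, x⟫)))

theorem norm_cexp_I_mul_ofReal (s : ℝ) : ‖Complex.exp (Complex.I * (s : ℂ))‖ = 1 := by
  rw [mul_comm, Complex.norm_exp_ofReal_mul_I]

theorem norm_zpow_neg_two_le_one {R : ℝ} {ξ : Plane} (hξ : ξ ∈ annulus R) :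
    ‖ξ‖ ^ (-2 : ℤ) ≤ 1 := zpow_le_one_of_nonpos₀ hξ.1.le (by norm_num)

theorem hasFDerivAt_profile (R t : ℝ) (x : Plane) :
    ∃ T : Plane →L[ℝ] ℂ, HasFDerivAt (profile R t) T x ∧ ∀ e, T e = profileDeriv R t x e := by
  set D : Plane → Plane → (Plane →L[ℝ] ℂ) := fun x ξ =>
    ((‖ξ‖ ^ (-2 : ℤ) : ℝ) • (Complex.exp (Complex.I * Complex.ofReal (-t * ‖ξ‖ ^ 2 + ⟪ξ, x⟫)) *
      Complex.I)) • (Complex.ofRealCLM.comp (innerSL ℝ ξ)) with hD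
  have hmeasD : ∀ x, Measurable (D x) := by
    intro x
    have h1 : Measurable fun ξ : Plane => Complex.ofRealCLM.comp (innerSL ℝ ξ) :=
      ((ContinuousLinearMap.compL ℝ Plane ℝ ℂ Complex.ofRealCLM).continuous.comp
        (innerSL ℝ).continuous).measurable
    have h2 : Measurable fun ξ : Plane => ((‖ξ‖ ^ (-2 : ℤ) : ℝ) •
        (Complex.exp (Complex.I * Complex.ofReal (-t * ‖ξ‖ ^ 2 + ⟪ξ, x⟫)) * Complex.I)) := by
      fun_prop
    exact h2.smul h1
  have hDn : ∀ x, ∀ ξ ∈ annulus R, ‖D x ξ‖ ≤ R := by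
    intro x ξ hξ
    have h1 : ‖Complex.ofRealCLM.comp (innerSL ℝ ξ)‖ ≤ ‖ξ‖ := by
      refine ContinuousLinearMap.opNorm_le_bound _ (norm_nonneg _) fun y => ?_
      simp only [ContinuousLinearMap.comp_apply, Complex.ofRealCLM_apply, innerSL_apply_apply,
        Complex.norm_real]
      exact norm_inner_le_norm ξ y
    rw [hD, norm_smul, norm_smul, norm_mul, norm_cexp_I_mul_ofReal, Complex.norm_I, mul_one,
      mul_one, Real.norm_of_nonneg (by positivity)]
    have h2 := norm_zpow_neg_two_le_one hξ
    have h3 : (0 : ℝ) ≤ ‖ξ‖ ^ (-2 : ℤ) := by positivity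
    have h4 := hξ.2
    nlinarith [norm_nonneg ξ]
  have hI : ∀ x, IntegrableOn (fun ξ : Plane => D x ξ) (annulus R) := fun x =>
    integrableOn_annulus (hmeasD x).aestronglyMeasurable (hDn x)
  refine ⟨∫ ξ in annulus R, D x ξ, ?_, ?_⟩
  · refine hasFDerivAt_integral_of_dominated_of_fderiv_le (bound := fun _ => R) Filter.univ_mem
      (.of_forall fun y => ?_) ?_ (hmeasD x).aestronglyMeasurable ?_ ?_ ?_
    · exact Measurable.aestronglyMeasurable (by fun_prop)
    · refine integrableOn_annulus (C := 1) (Measurable.aestronglyMeasurable (by fun_prop))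
        fun ξ hξ => ?_
      rw [norm_smul, norm_cexp_I_mul_ofReal, mul_one, Real.norm_of_nonneg (by positivity)]
      exact norm_zpow_neg_two_le_one hξ
    · filter_upwards [ae_restrict_mem (measurableSet_annulus R)] with ξ hξ y _ using hDn y ξ hξ
    · exact integrableOn_const (volume_annulus_lt_top R).ne
    · refine .of_forall fun ξ y _ => ?_
      have h1 : HasFDerivAt (fun y : Plane => (-t * ‖ξ‖ ^ 2 + ⟪ξ, y⟫ : ℝ)) (innerSL ℝ ξ) y :=
        (innerSL ℝ ξ).hasFDerivAt.const_add _
      have h2 := ((Complex.ofRealCLM.hasFDerivAt.comp y h1).const_mul Complex.I).cexp.const_smul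
        (‖ξ‖ ^ (-2 : ℤ) : ℝ)
      refine h2.congr_fderiv ?_
      ext e
      simp [hD, mul_assoc]
  · intro e
    rw [ContinuousLinearMap.integral_apply (hI x)]
    unfold profileDeriv
    refine integral_congr_ae (.of_forall fun ξ => ?_)
    simp only [hD, smul_apply, ContinuousLinearMap.comp_apply,
      Complex.ofRealCLM_apply, innerSL_apply_apply, smul_eq_mul, Complex.real_smul]
    ring

theorem plancherel_annulus {R C : ℝ} (h : Plane → ℂ) (hm : Measurable h)
    (hC : ∀ ξ ∈ annulus R, ‖h ξ‖ ≤ C) :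
    Integrable (fun x : Plane =>
      ‖∫ ξ in annulus R, Complex.exp (Complex.I * (⟪ξ, x⟫ : ℝ)) * h ξ‖ ^ 2)
    ∧ ∫ x : Plane, ‖∫ ξ in annulus R, Complex.exp (Complex.I * (⟪ξ, x⟫ : ℝ)) * h ξ‖ ^ 2 =
      (2 * π) ^ 2 * ∫ ξ in annulus R, ‖h ξ‖ ^ 2 := by
  have hA := measurableSet_annulus R
  have h1 : Integrable ((annulus R).indicator h) :=
    (integrableOn_annulus hm.aestronglyMeasurable hC).integrable_indicator hA
  have h2 : MemLp ((annulus R).indicator h) 2 := by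
    rw [memLp_indicator_iff_restrict hA]
    have : IsFiniteMeasure (volume.restrict (annulus R)) :=
      ⟨by simpa using volume_annulus_lt_top R⟩
    exact MemLp.of_bound hm.aestronglyMeasurable C ((ae_restrict_iff' hA).2 (.of_forall hC))
  have := plancherel_exp h1 h2
  have e1 : ∀ x : Plane, ∫ ξ, Complex.exp (Complex.I * (⟪ξ, x⟫ : ℝ)) * (annulus R).indicator h ξ =
      ∫ ξ in annulus R, Complex.exp (Complex.I * (⟪ξ, x⟫ : ℝ)) * h ξ := by
    intro x
    rw [← integral_indicator hA]
    refine integral_congr_ae (.of_forall fun ξ => ?_)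
    by_cases hξ : ξ ∈ annulus R <;> simp [hξ]
  have e2 : ∫ ξ, ‖(annulus R).indicator h ξ‖ ^ 2 = ∫ ξ in annulus R, ‖h ξ‖ ^ 2 := by
    rw [← integral_indicator hA]
    refine integral_congr_ae (.of_forall fun ξ => ?_)
    by_cases hξ : ξ ∈ annulus R <;> simp [hξ]
  simpa only [e1, e2] using this

theorem integral_norm_profile_sq_le {R : ℝ} (hR : 1 ≤ R) :
    Integrable (fun x : Plane => ‖profile R 0 x‖ ^ 2) ∧
    ∫ x : Plane, ‖profile R 0 x‖ ^ 2 ≤ (2 * π) ^ 2 * π := by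
  have h := plancherel_annulus (R := R) (C := 1) (fun ξ => ((‖ξ‖ ^ (-2 : ℤ) : ℝ) : ℂ))
    (by fun_prop) fun ξ hξ => by
      rw [Complex.norm_real, Real.norm_of_nonneg (by positivity)]
      exact norm_zpow_neg_two_le_one hξ
  have e : ∀ x : Plane, ∫ ξ in annulus R, Complex.exp (Complex.I * (⟪ξ, x⟫ : ℝ)) *
      ((‖ξ‖ ^ (-2 : ℤ) : ℝ) : ℂ) = profile R 0 x := by
    intro x
    refine integral_congr_ae (.of_forall fun ξ => ?_)
    simp only [Complex.real_smul, neg_zero, zero_mul, zero_add]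
    ring
  simp only [e, Complex.norm_real, Real.norm_eq_abs, sq_abs] at h
  refine ⟨h.1, h.2.trans_le ?_⟩
  gcongr
  exact integral_annulus_norm_zpow_neg_two_sq_le hR

theorem integral_norm_profileDeriv_sq (R : ℝ) (e : Plane) :
    Integrable (fun x : Plane => ‖profileDeriv R 0 x e‖ ^ 2) ∧
    ∫ x : Plane, ‖profileDeriv R 0 x e‖ ^ 2 =
      (2 * π) ^ 2 * ∫ ξ in annulus R, (‖ξ‖ ^ (-2 : ℤ) * ⟪ξ, e⟫) ^ 2 := by
  have h := plancherel_annulus (R := R) (C := R * ‖e‖)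
    (fun ξ => Complex.I * ((‖ξ‖ ^ (-2 : ℤ) * ⟪ξ, e⟫ : ℝ) : ℂ))
    (by fun_prop) fun ξ hξ => by
      rw [norm_mul, Complex.norm_I, one_mul, Complex.norm_real, norm_mul,
        Real.norm_of_nonneg (by positivity)]
      have h1 := norm_zpow_neg_two_le_one hξ
      have h2 : (0 : ℝ) ≤ ‖ξ‖ ^ (-2 : ℤ) := by positivity
      have h3 := norm_inner_le_norm (𝕜 := ℝ) ξ e
      have h4 := hξ.2
      calc _ ≤ 1 * ‖(⟪ξ, e⟫ : ℝ)‖ := by gcongr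
        _ ≤ ‖ξ‖ * ‖e‖ := by rw [one_mul]; exact h3
        _ ≤ R * ‖e‖ := by gcongr
  have e1 : ∀ x : Plane, ∫ ξ in annulus R, Complex.exp (Complex.I * (⟪ξ, x⟫ : ℝ)) *
      (Complex.I * ((‖ξ‖ ^ (-2 : ℤ) * ⟪ξ, e⟫ : ℝ) : ℂ)) = profileDeriv R 0 x e := by
    intro x
    refine integral_congr_ae (.of_forall fun ξ => ?_)
    simp only [Complex.real_smul, neg_zero, zero_mul, zero_add, Complex.ofReal_mul]
    ring
  simpa only [e1, norm_mul Complex.I, Complex.norm_I, one_mul, Complex.norm_real,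
    Real.norm_eq_abs, sq_abs] using h

theorem opNorm_sq_le_sum_single (T : Plane →L[ℝ] ℂ) :
    ‖T‖ ^ 2 ≤ ‖T (EuclideanSpace.single 0 1)‖ ^ 2 + ‖T (EuclideanSpace.single 1 1)‖ ^ 2 := by
  set A := ‖T (EuclideanSpace.single 0 1)‖
  set B := ‖T (EuclideanSpace.single 1 1)‖
  have h : ‖T‖ ≤ √(A ^ 2 + B ^ 2) := by
    refine T.opNorm_le_bound (Real.sqrt_nonneg _) fun y => ?_
    have hy : y = y 0 • EuclideanSpace.single 0 1 + y 1 • EuclideanSpace.single 1 1 := by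
      ext i; fin_cases i <;> simp
    have h1 : ‖T y‖ ≤ |y 0| * A + |y 1| * B := by
      conv_lhs => rw [hy, map_add, map_smul, map_smul]
      refine (norm_add_le _ _).trans ?_
      rw [norm_smul, norm_smul, Real.norm_eq_abs, Real.norm_eq_abs]
    refine h1.trans ?_
    rw [EuclideanSpace.norm_eq, ← Real.sqrt_mul (by positivity)]
    apply Real.le_sqrt_of_sq_le
    simp only [Fin.sum_univ_two, Real.norm_eq_abs]
    nlinarith [sq_nonneg (|y 0| * B - |y 1| * A)]
  calc ‖T‖ ^ 2 ≤ √(A ^ 2 + B ^ 2) ^ 2 := by gcongr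
    _ = _ := Real.sq_sqrt (by positivity)

theorem integral_gradNormC_profile_sq_le {R : ℝ} (hR : 1 ≤ R) :
    ∫ x : Plane, gradNormC (profile R 0) x ^ 2 ≤ (2 * π) ^ 2 * (2 * π * Real.log R) := by
  have h0 := integral_norm_profileDeriv_sq R (EuclideanSpace.single 0 1)
  have h1 := integral_norm_profileDeriv_sq R (EuclideanSpace.single 1 1)
  have hle : ∫ x : Plane, gradNormC (profile R 0) x ^ 2 ≤
      ∫ x : Plane, (‖profileDeriv R 0 x (EuclideanSpace.single 0 1)‖ ^ 2 +
        ‖profileDeriv R 0 x (EuclideanSpace.single 1 1)‖ ^ 2) := by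
    refine integral_mono_of_nonneg (.of_forall fun x => by positivity) (h0.1.add h1.1)
      (.of_forall fun x => ?_)
    obtain ⟨T, hT, hTe⟩ := hasFDerivAt_profile R 0 x
    simp only [gradNormC, hT.fderiv, ← hTe]
    exact opNorm_sq_le_sum_single T
  refine hle.trans (le_of_eq ?_)
  have hintegr : ∀ e : Plane,
      IntegrableOn (fun ξ : Plane => (‖ξ‖ ^ (-2 : ℤ) * ⟪ξ, e⟫) ^ 2) (annulus R) := by
    intro e
    refine integrableOn_annulus (C := (R * ‖e‖) ^ 2)
      (Measurable.aestronglyMeasurable (by fun_prop)) fun ξ hξ => ?_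
    have h1 := norm_zpow_neg_two_le_one hξ
    have h2 : (0 : ℝ) ≤ ‖ξ‖ ^ (-2 : ℤ) := by positivity
    have h3 := norm_inner_le_norm (𝕜 := ℝ) ξ e
    have h4 := hξ.2
    rw [norm_pow, norm_mul, Real.norm_of_nonneg h2]
    refine pow_le_pow_left₀ (by positivity) ?_ 2
    calc _ ≤ 1 * ‖(⟪ξ, e⟫ : ℝ)‖ := by gcongr
        _ ≤ ‖ξ‖ * ‖e‖ := by rw [one_mul]; exact h3
        _ ≤ R * ‖e‖ := by gcongr
  rw [integral_add h0.1 h1.1, h0.2, h1.2, ← mul_add, ← integral_add (hintegr _) (hintegr _),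
    ← integral_annulus_norm_zpow_neg_two hR]
  congr 1
  refine setIntegral_congr_fun (measurableSet_annulus R) fun ξ hξ => ?_
  have hn : ‖ξ‖ ^ 2 = ξ 0 ^ 2 + ξ 1 ^ 2 := by
    rw [EuclideanSpace.real_norm_sq_eq]; simp
  have hpos : ‖ξ‖ ≠ 0 := (lt_trans one_pos hξ.1).ne'
  simp only [EuclideanSpace.inner_single_right, one_mul, conj_trivial, mul_pow, ← mul_add, ← hn,
    zpow_neg]
  field_simp

/-- The normalising factor of `wS`. -/
def amplitude (N : ℕ) : ℝ := √(2 * π / Real.log N) * (2 * π) ^ (-2 : ℤ)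

theorem wS_eq (a : ℝ) (N : ℕ) (t : ℝ) :
    wS a N t = fun x => amplitude N • profile (Real.exp (-a) * N) t x := rfl

theorem amplitude_nonneg (N : ℕ) : 0 ≤ amplitude N := by
  unfold amplitude; positivity

theorem amplitude_sq {N : ℕ} (hL : 0 < Real.log N) :
    amplitude N ^ 2 * (2 * π) ^ 2 = 1 / (2 * π * Real.log N) := by
  rw [amplitude, mul_pow, Real.sq_sqrt (by positivity), zpow_neg]
  norm_cast
  field_simp

theorem log_exp_neg_mul {a : ℝ} {N : ℕ} (hL : 0 < Real.log N) :
    Real.log (Real.exp (-a) * N) = Real.log N - a := by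
  have hN : (N : ℝ) ≠ 0 := by rintro h; simp [h] at hL
  rw [Real.log_mul (Real.exp_ne_zero _) hN, Real.log_exp]; ring

theorem gradNormC_wS (a : ℝ) (N : ℕ) (t : ℝ) (x : Plane) :
    gradNormC (wS a N t) x = amplitude N * gradNormC (profile (Real.exp (-a) * N) t) x := by
  obtain ⟨T, hT, -⟩ := hasFDerivAt_profile (Real.exp (-a) * N) t x
  rw [gradNormC, gradNormC, wS_eq, hT.fderiv, (hT.fun_const_smul (amplitude N)).fderiv, norm_smul,
    Real.norm_of_nonneg (amplitude_nonneg N)]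

theorem integral_gradNormC_wS_sq_le {a : ℝ} {N : ℕ} (hL : 0 < Real.log N)
    (hR : 1 ≤ Real.exp (-a) * N) :
    ∫ x : Plane, gradNormC (wS a N 0) x ^ 2 ≤ 1 - a / Real.log N := by
  simp only [gradNormC_wS, mul_pow, integral_const_mul]
  calc _ ≤ amplitude N ^ 2 * ((2 * π) ^ 2 * (2 * π * Real.log (Real.exp (-a) * N))) := by
        gcongr
        exact integral_gradNormC_profile_sq_le hR
    _ = 1 - a / Real.log N := by
        rw [← mul_assoc, amplitude_sq hL, log_exp_neg_mul hL]
        field_simp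

theorem integral_norm_wS_sq_le {a : ℝ} {N : ℕ} (hL : 0 < Real.log N)
    (hR : 1 ≤ Real.exp (-a) * N) :
    Integrable (fun x : Plane => ‖wS a N 0 x‖ ^ 2) ∧
      ∫ x : Plane, ‖wS a N 0 x‖ ^ 2 ≤ 1 / (2 * Real.log N) := by
  have h := integral_norm_profile_sq_le hR
  simp only [wS_eq, norm_smul, Real.norm_of_nonneg (amplitude_nonneg N), mul_pow,
    integral_const_mul]
  refine ⟨h.1.const_mul _, ?_⟩
  calc _ ≤ amplitude N ^ 2 * ((2 * π) ^ 2 * π) := by gcongr; exact h.2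
    _ = 1 / (2 * Real.log N) := by
        rw [← mul_assoc, amplitude_sq hL]
        field_simp

theorem energy_wS_lt_one {a : ℝ} {N : ℕ} (ha : 1 / 2 < a) (hL : 0 < Real.log N)
    (hR : 1 ≤ Real.exp (-a) * N) :
    (∫ x : Plane, gradNormC (wS a N 0) x ^ 2) + (∫ x : Plane, ‖wS a N 0 x‖ ^ 2) < 1 := by
  have h1 := integral_gradNormC_wS_sq_le hL hR
  have h2 := (integral_norm_wS_sq_le hL hR).2
  have h3 : 1 / (2 * Real.log N) < a / Real.log N := by
    rw [div_lt_div_iff₀ (by positivity) hL]; nlinarith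
  linarith

/-- The remainder of the quadratic Taylor expansion of the exponential. -/
def expTail (y : ℝ) : ℝ := Real.exp y - 1 - y - y ^ 2 / 2

theorem two_mul_FC (z : ℂ) : 2 * FC z = (4 * π)⁻¹ * expTail (4 * π * ‖z‖ ^ 2) := by
  unfold FC expTail
  field_simp
  ring

theorem expTail_nonneg {y : ℝ} (hy : 0 ≤ y) : 0 ≤ expTail y := by
  have := Real.quadratic_le_exp_of_nonneg hy
  unfold expTail; linarith

theorem expTail_le_exp {y : ℝ} (hy : 0 ≤ y) : expTail y ≤ Real.exp y := by
  unfold expTail; nlinarith [sq_nonneg y]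

theorem expTail_le {y : ℝ} (hy : 0 ≤ y) : expTail y ≤ y ^ 3 * Real.exp y := by
  rcases le_total 1 y with h | h
  · exact (expTail_le_exp hy).trans (le_mul_of_one_le_left (Real.exp_nonneg _) (one_le_pow₀ h))
  · have h1 := Real.exp_bound' hy h (n := 3) (by norm_num)
    have h2 := Real.one_le_exp hy
    simp only [Finset.sum_range_succ, Finset.sum_range_zero, Nat.factorial] at h1
    unfold expTail
    have h3 : 0 ≤ y ^ 3 := by positivity
    norm_num at h1
    nlinarith

/-- Bound of the exponent in the intermediate region `L / 2 ≥ σ = -log |x|`. -/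
theorem expTail_le_of_le_half {C L σ y : ℝ} (hC : 0 ≤ C) (hL : 0 < L) (hCL : 2 * C ^ 2 ≤ L)
    (hσ : 0 ≤ σ) (hσL : σ ≤ L / 2) (hy : 0 ≤ y) (hyσ : y ≤ 2 * (σ + C) ^ 2 / L) :
    expTail y ≤ 368640 * Real.exp (5 / 2 * C + 2) * L⁻¹ ^ 3 * Real.exp (3 / 2 * σ) := by
  have h1 : y ≤ σ + 2 * C + 2 := by
    refine hyσ.trans ?_
    rw [div_le_iff₀ hL]
    nlinarith [mul_nonneg hσ (sub_nonneg.2 hσL), mul_nonneg hC (sub_nonneg.2 hσL)]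
  have h2 : (σ + C) ^ 6 ≤ 46080 * Real.exp ((σ + C) / 2) := by
    have := Real.pow_div_factorial_le_exp ((σ + C) / 2) (by positivity) 6
    simp only [Nat.factorial] at this
    norm_num at this
    rw [div_pow, div_div, div_le_iff₀ (by norm_num)] at this
    linarith
  calc expTail y ≤ y ^ 3 * Real.exp y := expTail_le hy
    _ ≤ (2 * (σ + C) ^ 2 / L) ^ 3 * Real.exp (σ + 2 * C + 2) := by gcongr
    _ = 8 * (σ + C) ^ 6 * L⁻¹ ^ 3 * Real.exp (σ + 2 * C + 2) := by field_simp; ring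
    _ ≤ 8 * (46080 * Real.exp ((σ + C) / 2)) * L⁻¹ ^ 3 * Real.exp (σ + 2 * C + 2) := by gcongr
    _ = 368640 * (Real.exp ((σ + C) / 2) * Real.exp (σ + 2 * C + 2)) * L⁻¹ ^ 3 := by ring
    _ = 368640 * (Real.exp (5 / 2 * C + 2) * Real.exp (3 / 2 * σ)) * L⁻¹ ^ 3 := by
        rw [← Real.exp_add, ← Real.exp_add]; ring_nf
    _ = _ := by ring

/-- Bound of the exponent in the concentration region `σ = -log |x| ≥ L / 2`. -/
theorem expTail_le_of_half_le {C a L σ y m : ℝ} (hC : 0 ≤ C) (ha : 0 ≤ a) (hL : 0 < L)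
    (haL : 2 * a ≤ L) (hσL : L / 2 ≤ σ) (hy : 0 ≤ y) (hm : 0 ≤ m)
    (hym : y ≤ 2 * m ^ 2 / L) (hma : m ≤ L - a) (hmσ : m ≤ σ + C) :
    expTail y ≤ Real.exp (5 / 2 * (Real.log 2 + C)) * Real.exp (-a / 2) *
      (Real.exp L ^ 2 * (1 + Real.exp (L - σ)) ^ (-(5 / 2) : ℝ)) := by
  set b := max a (L - σ - C)
  have hb0 : a ≤ b := le_max_left _ _
  have hb1 : L - σ - C ≤ b := le_max_right _ _
  have hb2 : b ≤ L / 2 := max_le (by linarith) (by linarith)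
  have hmb : m ≤ L - b := by
    have : b ≤ L - m := max_le (by linarith) (by linarith)
    linarith
  have h1 : y ≤ 2 * L - 3 * b := by
    refine hym.trans ?_
    rw [div_le_iff₀ hL]
    have : m ^ 2 ≤ (L - b) ^ 2 := by gcongr
    nlinarith [mul_nonneg (ha.trans hb0) (sub_nonneg.2 hb2)]
  have h2 : Real.log (1 + Real.exp (L - σ)) ≤ Real.log 2 + max 0 (L - σ) := by
    rw [Real.log_le_iff_le_exp (by positivity), Real.exp_add, Real.exp_log two_pos]
    have h3 : Real.exp (L - σ) ≤ Real.exp (max 0 (L - σ)) := by gcongr; exact le_max_right _ _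
    have h4 : 1 ≤ Real.exp (max 0 (L - σ)) := Real.one_le_exp (le_max_left _ _)
    linarith
  have h3 : max 0 (L - σ) ≤ b + C := max_le (by linarith) (by linarith)
  refine (expTail_le_exp hy).trans ?_
  rw [Real.rpow_def_of_pos (by positivity), ← Real.exp_nat_mul, ← Real.exp_add, ← Real.exp_add,
    ← Real.exp_add, Real.exp_le_exp]
  push_cast
  linarith

theorem expTail_le_of_le_one {y m : ℝ} (hy : 0 ≤ y) (hym : y ≤ m) (hm : m ≤ 1) :
    expTail y ≤ 3 * m ^ 2 * y := by
  have h1 : Real.exp y ≤ 3 := (Real.exp_le_exp.2 (hym.trans hm)).trans Real.exp_one_lt_three.le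
  calc expTail y ≤ y ^ 3 * Real.exp y := expTail_le hy
    _ = y ^ 2 * Real.exp y * y := by ring
    _ ≤ m ^ 2 * 3 * y := by gcongr
    _ = _ := by ring

theorem norm_profile_le {R : ℝ} (hR : 1 ≤ R) (t : ℝ) (x : Plane) :
    ‖profile R t x‖ ≤ 2 * π * Real.log R := by
  rw [← integral_annulus_norm_zpow_neg_two hR]
  refine (norm_integral_le_integral_norm _).trans (le_of_eq ?_)
  refine integral_congr_ae (.of_forall fun ξ => ?_)
  simp only
  rw [norm_smul, norm_cexp_I_mul_ofReal, mul_one, Real.norm_of_nonneg (by positivity)]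

theorem four_pi_mul_norm_wS_sq_le {a : ℝ} {N : ℕ} {t m : ℝ} {x : Plane} (hL : 0 < Real.log N)
    (h : ‖profile (Real.exp (-a) * N) t x‖ ≤ 2 * π * m) :
    4 * π * ‖wS a N t x‖ ^ 2 ≤ 2 * m ^ 2 / Real.log N := by
  rw [wS_eq, norm_smul, Real.norm_of_nonneg (amplitude_nonneg N)]
  calc 4 * π * (amplitude N * ‖profile (Real.exp (-a) * N) t x‖) ^ 2
      ≤ 4 * π * (amplitude N * (2 * π * m)) ^ 2 := by
        have := amplitude_nonneg N
        gcongr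
    _ = 4 * π * m ^ 2 * (amplitude N ^ 2 * (2 * π) ^ 2) := by ring
    _ = _ := by rw [amplitude_sq hL]; field_simp; ring

theorem exists_two_mul_FC_wS_le : ∃ C A₁ A₂ A₃ : ℝ, 0 ≤ C ∧ 0 ≤ A₁ ∧ 0 ≤ A₂ ∧ 0 ≤ A₃ ∧
    ∀ (a : ℝ) (N : ℕ), 0 ≤ a → 0 < Real.log N → 2 * a ≤ Real.log N → 2 * C ^ 2 ≤ Real.log N →
    ∀ x : Plane, x ≠ 0 → 2 * FC (wS a N 0 x) ≤
      A₁ * (Real.log N)⁻¹ ^ 3 *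
        (Metric.ball (0 : Plane) 1).indicator (fun x => ‖x‖ ^ (-(3 / 2) : ℝ)) x +
      A₂ * Real.exp (-a / 2) * ((N : ℝ) ^ 2 * (1 + ‖(N : ℝ) • x‖) ^ (-(5 / 2) : ℝ)) +
      A₃ * (Real.log N)⁻¹ ^ 2 * ‖wS a N 0 x‖ ^ 2 := by
  obtain ⟨C, hC, hprof⟩ := exists_norm_profile_le
  refine ⟨C, (4 * π)⁻¹ * (368640 * Real.exp (5 / 2 * C + 2)),
    (4 * π)⁻¹ * Real.exp (5 / 2 * (Real.log 2 + C)), 12 * C ^ 4, hC, by positivity, by positivity,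
    by positivity, fun a N ha hL haL hCL x hx => ?_⟩
  have hN : (0 : ℝ) < N := by
    rcases Nat.eq_zero_or_pos N with h | h
    · simp [h] at hL
    · exact_mod_cast h
  set L := Real.log N with hLdef
  have hexpL : Real.exp L = N := Real.exp_log hN
  have hR : 1 ≤ Real.exp (-a) * N := by
    rw [← hexpL, ← Real.exp_add]; exact Real.one_le_exp (by linarith)
  set s := ‖x‖ with hs
  have hs0 : 0 < s := norm_pos_iff.2 hx
  set y := 4 * π * ‖wS a N 0 x‖ ^ 2 with hydef
  have hy : 0 ≤ y := by positivity
  have hnormprof : ‖profile (Real.exp (-a) * N) 0 x‖ ≤ 2 * π * (max 0 (-Real.log s) + C) := by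
    simpa only [profile, neg_zero, zero_mul, zero_add] using hprof _ hR x hx
  have hy1 := four_pi_mul_norm_wS_sq_le hL hnormprof
  have hterm1 : 0 ≤ (4 * π)⁻¹ * (368640 * Real.exp (5 / 2 * C + 2)) * L⁻¹ ^ 3 *
      (Metric.ball (0 : Plane) 1).indicator (fun x => ‖x‖ ^ (-(3 / 2) : ℝ)) x :=
    mul_nonneg (by positivity) (Set.indicator_nonneg (fun _ _ => by positivity) _)
  have hterm2 : 0 ≤ (4 * π)⁻¹ * Real.exp (5 / 2 * (Real.log 2 + C)) * Real.exp (-a / 2) *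
      ((N : ℝ) ^ 2 * (1 + ‖(N : ℝ) • x‖) ^ (-(5 / 2) : ℝ)) := by positivity
  have hterm3 : 0 ≤ 12 * C ^ 4 * L⁻¹ ^ 2 * ‖wS a N 0 x‖ ^ 2 := by positivity
  rw [two_mul_FC]
  rcases le_or_gt 1 s with hs1 | hs1
  · rw [max_eq_left (by linarith [Real.log_nonneg hs1]), zero_add] at hy1
    have h := expTail_le_of_le_one hy hy1 (by rw [div_le_one hL]; exact hCL)
    have : (4 * π)⁻¹ * expTail y ≤ 12 * C ^ 4 * L⁻¹ ^ 2 * ‖wS a N 0 x‖ ^ 2 := by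
      calc (4 * π)⁻¹ * expTail y ≤ (4 * π)⁻¹ * (3 * (2 * C ^ 2 / L) ^ 2 * y) := by gcongr
        _ = _ := by rw [hydef]; field_simp; ring
    linarith
  · have hlog : Real.log s < 0 := Real.log_neg hs0 hs1
    rw [max_eq_right (by linarith)] at hy1 hnormprof
    rcases le_or_gt (-Real.log s) (L / 2) with hσ | hσ
    · have h := expTail_le_of_le_half hC hL hCL (by linarith) hσ hy hy1
      have hmem : x ∈ Metric.ball (0 : Plane) 1 := by simpa using hs1
      rw [Set.indicator_of_mem hmem, Real.rpow_def_of_pos hs0] at hterm1 ⊢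
      have : (4 * π)⁻¹ * expTail y ≤ (4 * π)⁻¹ * (368640 * Real.exp (5 / 2 * C + 2)) * L⁻¹ ^ 3 *
          Real.exp (Real.log s * -(3 / 2)) := by
        calc _ ≤ (4 * π)⁻¹ * (368640 * Real.exp (5 / 2 * C + 2) * L⁻¹ ^ 3 *
            Real.exp (3 / 2 * -Real.log s)) := by gcongr
          _ = _ := by ring_nf
      linarith
    · have hmin : ‖profile (Real.exp (-a) * N) 0 x‖ ≤ 2 * π * min (L - a) (-Real.log s + C) := by
        rw [mul_min_of_nonneg _ _ (by positivity)]
        refine le_min ?_ hnormprof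
        rw [← log_exp_neg_mul hL]
        exact norm_profile_le hR 0 x
      have h := expTail_le_of_half_le hC ha hL haL hσ.le hy (le_min (by linarith) (by linarith))
        (four_pi_mul_norm_wS_sq_le hL hmin) (min_le_left _ _) (min_le_right _ _)
      rw [sub_neg_eq_add, Real.exp_add, hexpL, Real.exp_log hs0] at h
      rw [norm_smul, Real.norm_of_nonneg hN.le] at hterm2 ⊢
      have : (4 * π)⁻¹ * expTail y ≤ (4 * π)⁻¹ * Real.exp (5 / 2 * (Real.log 2 + C)) *
          Real.exp (-a / 2) * ((N : ℝ) ^ 2 * (1 + N * s) ^ (-(5 / 2) : ℝ)) := by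
        simpa only [mul_assoc] using
          mul_le_mul_of_nonneg_left h (by positivity : (0 : ℝ) ≤ (4 * π)⁻¹)
      linarith

theorem integrable_indicator_ball_rpow :
    Integrable ((Metric.ball (0 : Plane) 1).indicator (fun x => ‖x‖ ^ (-(3 / 2) : ℝ))) := by
  rw [integrable_indicator_iff measurableSet_ball]
  have h : LocallyIntegrable (fun x : Plane => ‖x‖ ^ (-(3 / 2) : ℝ)) := by
    refine locallyIntegrable_of_norm_le_rpow (C := 1) (α := 3 / 2) (by simp)
      (by simp; norm_num) (.of_forall fun x => ?_) (Measurable.aestronglyMeasurable (by fun_prop))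
    rw [one_mul, Real.norm_of_nonneg (by positivity)]
  exact (h.integrableOn_isCompact (isCompact_closedBall 0 1)).mono_set Metric.ball_subset_closedBall

theorem integral_rescaled_one_add_norm {N : ℝ} (hN : 0 < N) :
    Integrable (fun x : Plane => N ^ 2 * (1 + ‖N • x‖) ^ (-(5 / 2) : ℝ)) ∧
    ∫ x : Plane, N ^ 2 * (1 + ‖N • x‖) ^ (-(5 / 2) : ℝ) =
      ∫ x : Plane, (1 + ‖x‖) ^ (-(5 / 2) : ℝ) := by
  have h : Integrable (fun x : Plane => (1 + ‖x‖) ^ (-(5 / 2) : ℝ)) :=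
    integrable_one_add_norm (by simp; norm_num)
  refine ⟨((integrable_comp_smul_iff volume _ hN.ne').2 h).const_mul _, ?_⟩
  rw [integral_const_mul,
    Measure.integral_comp_smul volume (fun x : Plane => (1 + ‖x‖) ^ (-(5 / 2) : ℝ)) N]
  simp only [finrank_euclideanSpace, Fintype.card_fin, smul_eq_mul]
  rw [abs_of_nonneg (by positivity)]
  field_simp

theorem exists_integral_FC_wS_le (δ : ℝ) (hδ : 0 < δ) : ∃ a : ℝ, 1 / 2 < a ∧ ∃ L₀ : ℝ,
    ∀ N : ℕ, L₀ ≤ Real.log N → ∫ x : Plane, 2 * FC (wS a N 0 x) ≤ δ := by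
  obtain ⟨C, A₁, A₂, A₃, hC, hA₁, hA₂, hA₃, hb⟩ := exists_two_mul_FC_wS_le
  set I := ∫ x : Plane, (Metric.ball (0 : Plane) 1).indicator (fun x => ‖x‖ ^ (-(3 / 2) : ℝ)) x
  set J := ∫ x : Plane, (1 + ‖x‖) ^ (-(5 / 2) : ℝ)
  have hI : 0 ≤ I := integral_nonneg fun x => Set.indicator_nonneg (fun _ _ => by positivity) _
  have hJ : 0 ≤ J := integral_nonneg fun x => by positivity
  set a := 1 + 2 * (2 * (A₂ * J) / δ) with ha_def
  have ha : 1 ≤ a := by rw [ha_def, le_add_iff_nonneg_right]; positivity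
  set L₀ := max (max 1 (2 * a)) (max (2 * C ^ 2) (2 * (A₁ * I + A₃) / δ))
  refine ⟨a, by linarith, L₀, fun N hN => ?_⟩
  have h1 : 1 ≤ Real.log N := (le_max_left _ _).trans ((le_max_left _ _).trans hN)
  have h2 : 2 * a ≤ Real.log N := (le_max_right _ _).trans ((le_max_left _ _).trans hN)
  have h3 : 2 * C ^ 2 ≤ Real.log N := (le_max_left _ _).trans ((le_max_right _ _).trans hN)
  have h4 : 2 * (A₁ * I + A₃) / δ ≤ Real.log N :=
    (le_max_right _ _).trans ((le_max_right _ _).trans hN)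
  have hL : 0 < Real.log N := by linarith
  have hNpos : (0 : ℝ) < N := by
    rcases Nat.eq_zero_or_pos N with h | h
    · simp [h] at hL
    · exact_mod_cast h
  have hR : 1 ≤ Real.exp (-a) * N := by
    rw [← Real.exp_log hNpos, ← Real.exp_add]; exact Real.one_le_exp (by linarith)
  obtain ⟨hw, hwle⟩ := integral_norm_wS_sq_le hL hR
  obtain ⟨hj, hje⟩ := integral_rescaled_one_add_norm hNpos
  set L := Real.log N
  have i1 := integrable_indicator_ball_rpow.const_mul (A₁ * L⁻¹ ^ 3)
  have i2 := hj.const_mul (A₂ * Real.exp (-a / 2))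
  have i3 := hw.const_mul (A₃ * L⁻¹ ^ 2)
  have hne : ∀ᵐ x : Plane, x ≠ 0 := by simp [ae_iff]
  have hmono := integral_mono_of_nonneg (μ := volume) (f := fun x => 2 * FC (wS a N 0 x))
    (.of_forall fun x => by
      change 0 ≤ 2 * FC (wS a N 0 x)
      rw [two_mul_FC]
      exact mul_nonneg (by positivity) (expTail_nonneg (by positivity)))
    ((i1.add i2).add i3) (hne.mono fun x hx => hb a N (by linarith) hL h2 h3 x hx)
  refine hmono.trans ?_
  rw [integral_add' (i1.add i2) i3, integral_add' i1 i2,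
    integral_const_mul (A₁ * _), integral_const_mul (A₂ * _), integral_const_mul (A₃ * _), hje]
  have hLinv : L⁻¹ ≤ 1 := inv_le_one_of_one_le₀ h1
  have hLinv0 : 0 ≤ L⁻¹ := by positivity
  have hpow : L⁻¹ ^ 3 ≤ L⁻¹ := pow_le_of_le_one hLinv0 hLinv (by norm_num)
  have b3 : A₃ * L⁻¹ ^ 2 * ∫ x, ‖wS a N 0 x‖ ^ 2 ≤ A₃ * L⁻¹ := by
    have e : 1 / (2 * L) ≤ L⁻¹ := by
      rw [one_div, mul_inv]; linarith
    calc _ ≤ A₃ * L⁻¹ ^ 2 * L⁻¹ := by gcongr; exact hwle.trans e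
      _ = A₃ * L⁻¹ ^ 3 := by ring
      _ ≤ _ := by gcongr
  have b1 : A₁ * L⁻¹ ^ 3 * I ≤ A₁ * I * L⁻¹ := by
    calc _ = A₁ * I * L⁻¹ ^ 3 := by ring
      _ ≤ _ := by gcongr
  have b13 : (A₁ * I + A₃) * L⁻¹ ≤ δ / 2 := by
    rw [← div_eq_mul_inv, div_le_iff₀ hL]
    rw [div_le_iff₀ hδ] at h4
    linarith
  have b2 : A₂ * Real.exp (-a / 2) * J ≤ δ / 2 := by
    have hexp : 2 * (A₂ * J) / δ ≤ Real.exp (a / 2) := by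
      have := Real.add_one_le_exp (a / 2); linarith
    rw [neg_div, Real.exp_neg]
    calc A₂ * (Real.exp (a / 2))⁻¹ * J = A₂ * J / Real.exp (a / 2) := by ring
      _ ≤ δ / 2 := by
        rw [div_le_iff₀ (Real.exp_pos _)]
        rw [div_le_iff₀ hδ] at hexp
        linarith
  change A₁ * L⁻¹ ^ 3 * I + _ + _ ≤ δ
  linarith

theorem setIntegral_annulus_eq_of_symm {R : ℝ} {g k : Plane → ℝ}
    (hg : IntegrableOn g (annulus R)) (h : ∀ ξ, g ξ + g (-ξ) = 2 * k ξ) :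
    ∫ ξ in annulus R, g ξ = ∫ ξ in annulus R, k ξ := by
  have hA := measurableSet_annulus R
  have hneg : ∀ ξ : Plane, (annulus R).indicator (fun ξ => g (-ξ)) ξ =
      (annulus R).indicator g (-ξ) := fun ξ => by
    simp [Set.indicator_apply, annulus]
  have h1 : ∫ ξ in annulus R, g (-ξ) = ∫ ξ in annulus R, g ξ := by
    rw [← integral_indicator hA, ← integral_indicator hA]
    simp only [hneg]
    exact integral_neg_eq_self ((annulus R).indicator g) volume
  have h2 : IntegrableOn (fun ξ => g (-ξ)) (annulus R) := by
    rw [← integrable_indicator_iff hA]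
    refine (hg.integrable_indicator hA).comp_neg.congr (.of_forall fun ξ => ?_)
    exact (hneg ξ).symm
  have h3 : 2 * ∫ ξ in annulus R, k ξ = 2 * ∫ ξ in annulus R, g ξ := by
    rw [← integral_const_mul]
    simp only [← h]
    rw [integral_add hg h2, h1]; ring
  linarith

theorem cexp_I_mul_phase (t s u : ℝ) :
    Complex.exp (Complex.I * Complex.ofReal (-t * u + s)) =
      ((Real.cos (s - t * u) : ℝ) : ℂ) + ((Real.sin (s - t * u) : ℝ) : ℂ) * Complex.I := by
  rw [mul_comm, Complex.exp_mul_I, ← Complex.ofReal_cos, ← Complex.ofReal_sin]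
  ring_nf

theorem integrableOn_profile (R t : ℝ) (x : Plane) :
    IntegrableOn (fun ξ : Plane => (‖ξ‖ ^ (-2 : ℤ) : ℝ) •
      Complex.exp (Complex.I * Complex.ofReal (-t * ‖ξ‖ ^ 2 + ⟪ξ, x⟫))) (annulus R) := by
  refine integrableOn_annulus (C := 1) (Measurable.aestronglyMeasurable (by fun_prop))
    fun ξ hξ => ?_
  rw [norm_smul, norm_cexp_I_mul_ofReal, mul_one, Real.norm_of_nonneg (by positivity)]
  exact norm_zpow_neg_two_le_one hξ

theorem norm_profileDeriv_integrand_le {R : ℝ} (t : ℝ) (x e : Plane) {ξ : Plane}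
    (hξ : ξ ∈ annulus R) :
    ‖(‖ξ‖ ^ (-2 : ℤ) : ℝ) • ((Complex.I * (⟪ξ, e⟫ : ℝ)) *
      Complex.exp (Complex.I * Complex.ofReal (-t * ‖ξ‖ ^ 2 + ⟪ξ, x⟫)))‖ ≤ R * ‖e‖ := by
  rw [norm_smul, norm_mul, norm_mul, norm_cexp_I_mul_ofReal, mul_one, Complex.norm_I, one_mul,
    Complex.norm_real, Real.norm_of_nonneg (by positivity)]
  have h1 := norm_zpow_neg_two_le_one hξ
  have h3 := norm_inner_le_norm (𝕜 := ℝ) ξ e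
  have h4 := hξ.2
  calc _ ≤ 1 * ‖(⟪ξ, e⟫ : ℝ)‖ := by gcongr
    _ ≤ ‖ξ‖ * ‖e‖ := by rw [one_mul]; exact h3
    _ ≤ R * ‖e‖ := by gcongr

theorem integrableOn_profileDeriv (R t : ℝ) (x e : Plane) :
    IntegrableOn (fun ξ : Plane => (‖ξ‖ ^ (-2 : ℤ) : ℝ) • ((Complex.I * (⟪ξ, e⟫ : ℝ)) *
      Complex.exp (Complex.I * Complex.ofReal (-t * ‖ξ‖ ^ 2 + ⟪ξ, x⟫)))) (annulus R) :=
  integrableOn_annulus (Measurable.aestronglyMeasurable (by fun_prop))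
    fun _ hξ => norm_profileDeriv_integrand_le t x e hξ

theorem profile_re (R t : ℝ) (x : Plane) : (profile R t x).re =
    ∫ ξ in annulus R, ‖ξ‖ ^ (-2 : ℤ) * (Real.cos ⟪ξ, x⟫ * Real.cos (t * ‖ξ‖ ^ 2)) := by
  have hI := integrableOn_profile R t x
  rw [profile, ← Complex.reCLM_apply, ← Complex.reCLM.integral_comp_comm hI]
  refine setIntegral_annulus_eq_of_symm (Complex.reCLM.integrable_comp hI) fun ξ => ?_
  simp only [cexp_I_mul_phase, Complex.reCLM_apply, Complex.smul_re, Complex.add_re,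
    Complex.ofReal_re, Complex.re_ofReal_mul, Complex.I_re, norm_neg, inner_neg_left, mul_zero,
    add_zero, smul_eq_mul, Real.cos_sub, Real.cos_neg, Real.sin_neg]
  ring

theorem profile_im (R t : ℝ) (x : Plane) : (profile R t x).im =
    ∫ ξ in annulus R, -(‖ξ‖ ^ (-2 : ℤ) * (Real.cos ⟪ξ, x⟫ * Real.sin (t * ‖ξ‖ ^ 2))) := by
  have hI := integrableOn_profile R t x
  rw [profile, ← Complex.imCLM_apply, ← Complex.imCLM.integral_comp_comm hI]
  refine setIntegral_annulus_eq_of_symm (Complex.imCLM.integrable_comp hI) fun ξ => ?_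
  simp only [cexp_I_mul_phase, Complex.imCLM_apply, Complex.smul_im, Complex.add_im,
    Complex.ofReal_im, Complex.im_ofReal_mul, Complex.I_im, norm_neg, inner_neg_left, mul_one,
    zero_add, smul_eq_mul, Real.sin_sub, Real.cos_neg, Real.sin_neg]
  ring

theorem profileDeriv_re (R t : ℝ) (x : Plane) : (profileDeriv R t x x).re =
    ∫ ξ in annulus R,
      -(‖ξ‖ ^ (-2 : ℤ) * (⟪ξ, x⟫ * Real.sin ⟪ξ, x⟫ * Real.cos (t * ‖ξ‖ ^ 2))) := by
  have hI := integrableOn_profileDeriv R t x x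
  rw [profileDeriv, ← Complex.reCLM_apply, ← Complex.reCLM.integral_comp_comm hI]
  refine setIntegral_annulus_eq_of_symm (Complex.reCLM.integrable_comp hI) fun ξ => ?_
  simp only [cexp_I_mul_phase, Complex.reCLM_apply, Complex.smul_re, Complex.add_re,
    Complex.add_im, Complex.mul_re, Complex.mul_im, Complex.ofReal_re, Complex.ofReal_im,
    Complex.I_re, Complex.I_im, norm_neg, inner_neg_left, smul_eq_mul, Real.cos_sub, Real.sin_sub,
    Real.cos_neg, Real.sin_neg]
  ring

theorem profileDeriv_im (R t : ℝ) (x : Plane) : (profileDeriv R t x x).im =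
    ∫ ξ in annulus R,
      ‖ξ‖ ^ (-2 : ℤ) * (⟪ξ, x⟫ * Real.sin ⟪ξ, x⟫ * Real.sin (t * ‖ξ‖ ^ 2)) := by
  have hI := integrableOn_profileDeriv R t x x
  rw [profileDeriv, ← Complex.imCLM_apply, ← Complex.imCLM.integral_comp_comm hI]
  refine setIntegral_annulus_eq_of_symm (Complex.imCLM.integrable_comp hI) fun ξ => ?_
  simp only [cexp_I_mul_phase, Complex.imCLM_apply, Complex.smul_im, Complex.add_re,
    Complex.add_im, Complex.mul_re, Complex.mul_im, Complex.ofReal_re, Complex.ofReal_im,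
    Complex.I_re, Complex.I_im, norm_neg, inner_neg_left, smul_eq_mul, Real.cos_sub, Real.sin_sub,
    Real.cos_neg, Real.sin_neg]
  ring

theorem sq_div_two_le_mul_sin {s : ℝ} (hs : |s| ≤ 1) : s ^ 2 / 2 ≤ s * Real.sin s := by
  have key : ∀ r : ℝ, 0 ≤ r → r ≤ 1 → r ^ 2 / 2 ≤ r * Real.sin r := fun r h0 h1 => by
    have h2 := Real.mul_le_sin h0 (by linarith [Real.pi_gt_three])
    have h3 : 1 / 2 ≤ 2 / π := by
      rw [div_le_div_iff₀ two_pos Real.pi_pos]; linarith [Real.pi_le_four]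
    nlinarith
  rw [abs_le] at hs
  rcases le_total 0 s with h | h
  · exact key s h hs.2
  · simpa using key (-s) (by linarith) (by linarith)

theorem half_le_cos {s : ℝ} (hs : |s| ≤ 1) : 1 / 2 ≤ Real.cos s := by
  have := Real.one_sub_sq_div_two_le_cos (x := s)
  have := (sq_le_one_iff_abs_le_one s).2 hs
  linarith

theorem sin_nonneg_of_le_one {s : ℝ} (h0 : 0 ≤ s) (h1 : s ≤ 1) : 0 ≤ Real.sin s :=
  Real.sin_nonneg_of_nonneg_of_le_pi h0 (by linarith [Real.pi_gt_three])

section LowerBounds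

variable {R t : ℝ} {x : Plane}

theorem abs_inner_le_one_of_mem_annulus (hx : R * ‖x‖ ≤ 1) {ξ : Plane} (hξ : ξ ∈ annulus R) :
    |(⟪ξ, x⟫ : ℝ)| ≤ 1 := by
  refine (abs_real_inner_le_norm ξ x).trans (le_trans ?_ hx)
  have := hξ.2
  gcongr

theorem mul_norm_sq_le_one_of_mem_annulus (ht : 0 ≤ t) (htR : t * R ^ 2 ≤ 1) {ξ : Plane}
    (hξ : ξ ∈ annulus R) : t * ‖ξ‖ ^ 2 ≤ 1 := by
  refine le_trans ?_ htR
  have := hξ.2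
  gcongr

theorem profile_re_ge (hR : 1 ≤ R) (ht : 0 ≤ t) (htR : t * R ^ 2 ≤ 1) (hx : R * ‖x‖ ≤ 1) :
    2 * π * Real.log R - π ≤ (profile R t x).re := by
  have hR0 : 0 < R := by linarith
  have hI1 : IntegrableOn (fun ξ : Plane => ‖ξ‖ ^ (-2 : ℤ)) (annulus R) :=
    integrableOn_annulus (C := 1) (Measurable.aestronglyMeasurable (by fun_prop)) fun ξ hξ => by
      rw [Real.norm_of_nonneg (by positivity)]; exact norm_zpow_neg_two_le_one hξ
  have hI2 : IntegrableOn (fun _ : Plane => (R ^ 2)⁻¹ * (1 : ℝ)) (annulus R) :=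
    integrableOn_const (volume_annulus_lt_top R).ne
  have hI3 : IntegrableOn (fun ξ : Plane =>
      ‖ξ‖ ^ (-2 : ℤ) * (Real.cos ⟪ξ, x⟫ * Real.cos (t * ‖ξ‖ ^ 2))) (annulus R) :=
    integrableOn_annulus (C := 1) (Measurable.aestronglyMeasurable (by fun_prop)) fun ξ hξ => by
      rw [norm_mul, norm_mul, Real.norm_of_nonneg (by positivity)]
      have h1 := Real.abs_cos_le_one ⟪ξ, x⟫
      have h2 := Real.abs_cos_le_one (t * ‖ξ‖ ^ 2)
      have h3 := norm_zpow_neg_two_le_one hξ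
      exact mul_le_one₀ h3 (by positivity) (mul_le_one₀ h1 (by positivity) h2)
  rw [profile_re]
  have hone := integral_annulus_one_le hR
  calc 2 * π * Real.log R - π
      ≤ ∫ ξ in annulus R, (‖ξ‖ ^ (-2 : ℤ) - (R ^ 2)⁻¹ * (1 : ℝ)) := by
        rw [integral_sub hI1 hI2, integral_annulus_norm_zpow_neg_two hR, integral_const_mul]
        have : (R ^ 2)⁻¹ * ∫ _ξ in annulus R, (1 : ℝ) ≤ (R ^ 2)⁻¹ * (π * R ^ 2) := by gcongr
        have h2 : (R ^ 2)⁻¹ * (π * R ^ 2) = π := by field_simp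
        linarith
    _ ≤ _ := by
        refine setIntegral_mono_on (hI1.sub hI2) hI3 (measurableSet_annulus R) fun ξ hξ => ?_
        have hξ0 : 0 < ‖ξ‖ := one_pos.trans hξ.1
        have h1 := Real.one_sub_sq_div_two_le_cos (x := ⟪ξ, x⟫)
        have h2 := Real.one_sub_sq_div_two_le_cos (x := t * ‖ξ‖ ^ 2)
        have h1' := Real.cos_le_one ⟪ξ, x⟫
        have h2' := Real.cos_le_one (t * ‖ξ‖ ^ 2)
        have h3 : (⟪ξ, x⟫ : ℝ) ^ 2 ≤ ‖ξ‖ ^ 2 * (R ^ 2)⁻¹ := by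
          have hxR : ‖x‖ ≤ R⁻¹ := by rwa [← one_div, le_div_iff₀' hR0]
          have := abs_real_inner_le_norm ξ x
          calc (⟪ξ, x⟫ : ℝ) ^ 2 = |(⟪ξ, x⟫ : ℝ)| ^ 2 := (sq_abs _).symm
            _ ≤ (‖ξ‖ * R⁻¹) ^ 2 := by
              refine pow_le_pow_left₀ (abs_nonneg _) (this.trans ?_) 2
              gcongr
            _ = _ := by rw [mul_pow, inv_pow]
        have h4 : (t * ‖ξ‖ ^ 2) ^ 2 ≤ ‖ξ‖ ^ 2 * (R ^ 2)⁻¹ := by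
          have htR' : t ≤ (R ^ 2)⁻¹ := by rwa [← one_div, le_div_iff₀ (by positivity)]
          have hle := mul_norm_sq_le_one_of_mem_annulus ht htR hξ
          calc (t * ‖ξ‖ ^ 2) ^ 2 = (t * ‖ξ‖ ^ 2) * (‖ξ‖ ^ 2 * t) := by ring
            _ ≤ 1 * (‖ξ‖ ^ 2 * (R ^ 2)⁻¹) := by gcongr
            _ = _ := one_mul _
        have h5 : 1 - ‖ξ‖ ^ 2 * (R ^ 2)⁻¹ ≤ Real.cos ⟪ξ, x⟫ * Real.cos (t * ‖ξ‖ ^ 2) := by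
          nlinarith [mul_nonneg (sub_nonneg.2 h1') (sub_nonneg.2 h2')]
        calc ‖ξ‖ ^ (-2 : ℤ) - (R ^ 2)⁻¹ * 1
            = ‖ξ‖ ^ (-2 : ℤ) * (1 - ‖ξ‖ ^ 2 * (R ^ 2)⁻¹) := by
              rw [zpow_neg]; norm_cast; field_simp
          _ ≤ _ := by gcongr

theorem profile_im_nonpos (ht : 0 ≤ t) (htR : t * R ^ 2 ≤ 1) (hx : R * ‖x‖ ≤ 1) :
    (profile R t x).im ≤ 0 := by
  rw [profile_im]
  refine setIntegral_nonpos (measurableSet_annulus R) fun ξ hξ => neg_nonpos.2 ?_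
  have h1 := half_le_cos (abs_inner_le_one_of_mem_annulus hx hξ)
  have h2 := sin_nonneg_of_le_one (by positivity) (mul_norm_sq_le_one_of_mem_annulus ht htR hξ)
  exact mul_nonneg (by positivity) (mul_nonneg (by linarith) h2)

theorem profileDeriv_im_nonneg (ht : 0 ≤ t) (htR : t * R ^ 2 ≤ 1) (hx : R * ‖x‖ ≤ 1) :
    0 ≤ (profileDeriv R t x x).im := by
  rw [profileDeriv_im]
  refine setIntegral_nonneg (measurableSet_annulus R) fun ξ hξ => ?_
  have h1 := sq_div_two_le_mul_sin (abs_inner_le_one_of_mem_annulus hx hξ)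
  have h2 := sin_nonneg_of_le_one (by positivity) (mul_norm_sq_le_one_of_mem_annulus ht htR hξ)
  exact mul_nonneg (by positivity) (mul_nonneg (le_trans (by positivity) h1) h2)

theorem profileDeriv_re_le (hR : 1 ≤ R) (ht : 0 ≤ t) (htR : t * R ^ 2 ≤ 1) (hx : R * ‖x‖ ≤ 1) :
    (profileDeriv R t x x).re ≤ -(π * ‖x‖ ^ 2 * (R ^ 2 - 1) / 8) := by
  rw [profileDeriv_re, integral_neg, neg_le_neg_iff]
  have hle : ∀ ξ ∈ annulus R, (1 / 4 : ℝ) * (‖ξ‖ ^ (-2 : ℤ) * ⟪ξ, x⟫ ^ 2) ≤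
      ‖ξ‖ ^ (-2 : ℤ) * (⟪ξ, x⟫ * Real.sin ⟪ξ, x⟫ * Real.cos (t * ‖ξ‖ ^ 2)) := fun ξ hξ => by
    have h0 := mul_norm_sq_le_one_of_mem_annulus ht htR hξ
    have h1 := sq_div_two_le_mul_sin (abs_inner_le_one_of_mem_annulus hx hξ)
    have h2 := half_le_cos (s := t * ‖ξ‖ ^ 2) (by rwa [abs_of_nonneg (by positivity)])
    calc _ = ‖ξ‖ ^ (-2 : ℤ) * ((⟪ξ, x⟫ : ℝ) ^ 2 / 2 * (1 / 2)) := by ring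
      _ ≤ _ := by gcongr; exact le_trans (by positivity) h1
  have hbd : ∀ ξ ∈ annulus R, ‖ξ‖ ^ (-2 : ℤ) * |(⟪ξ, x⟫ : ℝ)| ≤ 1 := fun ξ hξ =>
    mul_le_one₀ (norm_zpow_neg_two_le_one hξ) (abs_nonneg _) (abs_inner_le_one_of_mem_annulus hx hξ)
  have hI0 : IntegrableOn (fun ξ : Plane => ‖ξ‖ ^ (-2 : ℤ) * ⟪ξ, x⟫ ^ 2) (annulus R) := by
    refine integrableOn_annulus (C := 1) (Measurable.aestronglyMeasurable (by fun_prop))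
      fun ξ hξ => ?_
    rw [norm_mul, norm_pow, Real.norm_of_nonneg (by positivity), Real.norm_eq_abs, sq, ← mul_assoc]
    exact mul_le_one₀ (hbd ξ hξ) (abs_nonneg _) (abs_inner_le_one_of_mem_annulus hx hξ)
  have hI1 : IntegrableOn (fun ξ : Plane => (1 / 4 : ℝ) * (‖ξ‖ ^ (-2 : ℤ) * ⟪ξ, x⟫ ^ 2))
      (annulus R) := Integrable.const_mul hI0 _
  have hI2 : IntegrableOn (fun ξ : Plane => ‖ξ‖ ^ (-2 : ℤ) *
      (⟪ξ, x⟫ * Real.sin ⟪ξ, x⟫ * Real.cos (t * ‖ξ‖ ^ 2))) (annulus R) := by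
    refine integrableOn_annulus (C := 1) (Measurable.aestronglyMeasurable (by fun_prop))
      fun ξ hξ => ?_
    rw [norm_mul, norm_mul, norm_mul, Real.norm_of_nonneg (by positivity), Real.norm_eq_abs,
      mul_assoc |(⟪ξ, x⟫ : ℝ)|, ← mul_assoc]
    exact mul_le_one₀ (hbd ξ hξ) (by positivity)
      (mul_le_one₀ (Real.abs_sin_le_one _) (by positivity) (Real.abs_cos_le_one _))
  calc _ = ∫ ξ in annulus R, (1 / 4 : ℝ) * (‖ξ‖ ^ (-2 : ℤ) * ⟪ξ, x⟫ ^ 2) := by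
        rw [integral_const_mul, integral_annulus_inner_sq hR]; ring
    _ ≤ _ := setIntegral_mono_on hI1 hI2 (measurableSet_annulus R) hle

theorem inner_profile_profileDeriv_le (hR : 1 ≤ R) (hlog : 1 / 2 ≤ Real.log R) (ht : 0 ≤ t)
    (htR : t * R ^ 2 ≤ 1) (hx : R * ‖x‖ ≤ 1) :
    ⟪profile R t x, profileDeriv R t x x⟫ ≤
      -((2 * π * Real.log R - π) * (π * ‖x‖ ^ 2 * (R ^ 2 - 1) / 8)) := by
  have h1 := profile_re_ge hR ht htR hx
  have h2 := profile_im_nonpos ht htR hx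
  have h3 := profileDeriv_re_le hR ht htR hx
  have h4 := profileDeriv_im_nonneg ht htR hx
  have h5 : 0 ≤ 2 * π * Real.log R - π := by nlinarith [Real.pi_pos]
  have h6 : 0 ≤ π * ‖x‖ ^ 2 * (R ^ 2 - 1) / 8 := by
    have : 0 ≤ R ^ 2 - 1 := by nlinarith
    positivity
  rw [Complex.inner]
  simp only [Complex.mul_re, Complex.conj_re, Complex.conj_im]
  have h7 : (2 * π * Real.log R - π) * (π * ‖x‖ ^ 2 * (R ^ 2 - 1) / 8) ≤
      (profile R t x).re * -(profileDeriv R t x x).re :=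
    mul_le_mul h1 (by linarith) h6 (h5.trans h1)
  have h8 := mul_nonneg (neg_nonneg.2 h2) h4
  linarith

end LowerBounds

theorem hasFDerivAt_fC_comp {w : Plane → ℂ} {T : Plane →L[ℝ] ℂ} {x : Plane}
    (hw : HasFDerivAt w T x) : ∃ S : Plane →L[ℝ] ℂ, HasFDerivAt (fun y => fC (w y)) S x ∧
      ∀ e, S e = (Real.exp (4 * π * ‖w x‖ ^ 2) - 1 - 4 * π * ‖w x‖ ^ 2) • T e +
        (8 * π * (Real.exp (4 * π * ‖w x‖ ^ 2) - 1) * ⟪w x, T e⟫) • w x := by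
  have h1 := (hw.norm_sq).const_mul (4 * π)
  have h2 := ((h1.exp.sub_const 1).sub h1).smul hw
  refine ⟨_, h2.congr_of_eventuallyEq (.of_forall fun y => ?_), fun e => ?_⟩
  · simp only [fC, Pi.smul_apply', Pi.sub_apply, Complex.real_smul]
  · simp only [Pi.sub_apply, add_apply, smul_apply,
      ContinuousLinearMap.smulRight_apply, ContinuousLinearMap.comp_apply, innerSL_apply_apply,
      sub_apply, nsmul_eq_mul, smul_eq_mul]
    congr 2
    push_cast
    ring

theorem le_norm_fderiv_fC_comp {w : Plane → ℂ} {T : Plane →L[ℝ] ℂ} {x : Plane}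
    (hw : HasFDerivAt w T x) (hx : w x ≠ 0) (e : Plane) :
    8 * π * (Real.exp (4 * π * ‖w x‖ ^ 2) - 1) * ‖w x‖ * -⟪w x, T e⟫ ≤
      ‖fderiv ℝ (fun y => fC (w y)) x‖ * ‖e‖ := by
  obtain ⟨S, hS, hSe⟩ := hasFDerivAt_fC_comp hw
  rw [hS.fderiv]
  refine le_trans ?_ (S.le_opNorm e)
  have hw0 : 0 < ‖w x‖ := norm_pos_iff.2 hx
  set g := Real.exp (4 * π * ‖w x‖ ^ 2) - 1 - 4 * π * ‖w x‖ ^ 2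
  set g' := Real.exp (4 * π * ‖w x‖ ^ 2) - 1 with hg'_def
  have hg : 0 ≤ g := by
    have := Real.add_one_le_exp (4 * π * ‖w x‖ ^ 2); simp only [g]; linarith
  have hg' : 0 ≤ g' := by
    rw [hg'_def, sub_nonneg]; exact Real.one_le_exp (by positivity)
  have hinner : ⟪w x, S e⟫ = (g + 8 * π * g' * ‖w x‖ ^ 2) * ⟪w x, T e⟫ := by
    rw [hSe, inner_add_right, real_inner_smul_right, real_inner_smul_right,
      real_inner_self_eq_norm_sq]
    ring
  rcases le_total 0 (⟪w x, T e⟫ : ℝ) with h | h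
  · refine le_trans ?_ (norm_nonneg _)
    exact mul_nonpos_of_nonneg_of_nonpos (by positivity) (neg_nonpos.2 h)
  · have h1 : -⟪w x, S e⟫ ≤ ‖w x‖ * ‖S e‖ :=
      (neg_le_abs _).trans (abs_real_inner_le_norm _ _)
    have h2 : 0 ≤ g * -⟪w x, T e⟫ := mul_nonneg hg (neg_nonneg.2 h)
    rw [hinner] at h1
    refine le_of_mul_le_mul_left ?_ hw0
    calc _ = 8 * π * g' * ‖w x‖ ^ 2 * -⟪w x, T e⟫ := by ring
      _ ≤ _ := by linarith

theorem norm_profileDeriv_le (R t : ℝ) (x e : Plane) :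
    ‖profileDeriv R t x e‖ ≤ R * volume.real (annulus R) * ‖e‖ := by
  refine (norm_setIntegral_le_of_norm_le_const (volume_annulus_lt_top R)
    fun ξ hξ => norm_profileDeriv_integrand_le t x e hξ).trans (le_of_eq ?_)
  ring

theorem exists_norm_fderiv_fC_wS_le {a : ℝ} {N : ℕ} (hR : 1 ≤ Real.exp (-a) * N) (t : ℝ) :
    ∃ M : ℝ, ∀ x, ‖fderiv ℝ (fun y => fC (wS a N t y)) x‖ ≤ M := by
  set R := Real.exp (-a) * N with hRdef
  set W := amplitude N * (2 * π * Real.log R) with hW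
  set D := amplitude N * (R * volume.real (annulus R))
  have hlog := Real.log_nonneg hR
  have hK := amplitude_nonneg N
  have hW0 : 0 ≤ W := by positivity
  refine ⟨Real.exp (4 * π * W ^ 2) * D + 8 * π * Real.exp (4 * π * W ^ 2) * (W * D) * W,
    fun x => ?_⟩
  obtain ⟨T, hT, hTe⟩ := hasFDerivAt_profile R t x
  have hw : HasFDerivAt (wS a N t) (amplitude N • T) x := by
    rw [wS_eq]; exact hT.fun_const_smul _
  obtain ⟨S, hS, hSe⟩ := hasFDerivAt_fC_comp hw
  have hwW : ‖wS a N t x‖ ≤ W := by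
    rw [wS_eq, norm_smul, Real.norm_of_nonneg hK]
    exact mul_le_mul_of_nonneg_left (norm_profile_le hR t x) hK
  have hTD : ∀ e, ‖(amplitude N • T) e‖ ≤ D * ‖e‖ := fun e => by
    rw [smul_apply, norm_smul, hTe, Real.norm_of_nonneg hK, mul_assoc]
    exact mul_le_mul_of_nonneg_left (norm_profileDeriv_le R t x e) hK
  rw [hS.fderiv]
  refine S.opNorm_le_bound (by positivity) fun e => ?_
  have hexp : Real.exp (4 * π * ‖wS a N t x‖ ^ 2) ≤ Real.exp (4 * π * W ^ 2) := by gcongr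
  have h1 : 0 ≤ 4 * π * ‖wS a N t x‖ ^ 2 := by positivity
  have h2 := Real.add_one_le_exp (4 * π * ‖wS a N t x‖ ^ 2)
  rw [hSe]
  refine (norm_add_le _ _).trans ?_
  rw [norm_smul, norm_smul, norm_mul, norm_mul, Real.norm_of_nonneg (by linarith : 0 ≤
    Real.exp (4 * π * ‖wS a N t x‖ ^ 2) - 1 - 4 * π * ‖wS a N t x‖ ^ 2),
    Real.norm_of_nonneg (by positivity : 0 ≤ 8 * π), Real.norm_of_nonneg (by linarith :
    0 ≤ Real.exp (4 * π * ‖wS a N t x‖ ^ 2) - 1)]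
  have h3 : ‖(⟪wS a N t x, (amplitude N • T) e⟫ : ℝ)‖ ≤ W * (D * ‖e‖) :=
    (norm_inner_le_norm _ _).trans (by gcongr; exact hTD e)
  calc _ ≤ Real.exp (4 * π * W ^ 2) * (D * ‖e‖) +
        8 * π * Real.exp (4 * π * W ^ 2) * (W * (D * ‖e‖)) * W := by
        gcongr
        · linarith
        · exact hTD e
        · linarith
    _ = _ := by ring

theorem gradient_lower_bound_arith {κ k E S L N s R A M : ℝ} (hκ : 0 ≤ κ) (hL : 0 < L)
    (hN : 0 < N) (hs : 0 ≤ s) (hkS : 0 ≤ k * S) (hA : A ^ 2 * (2 * π) ^ 2 = 1 / (2 * π * L))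
    (hR : R ^ 2 = E * N ^ 2) (hsN : 1 ≤ 8 * N * s) (hk : k * S ≤ A * M ^ 2 / L) :
    κ * k * π * E / 64 * S * N ^ 3 * s ≤
      8 * π * (κ * N ^ 2 / 2) * (A * (2 * π * M)) *
        (A ^ 2 * (2 * π * M * (π * s ^ 2 * (R ^ 2 / 2) / 8))) := by
  have hE : 0 ≤ E := by
    by_contra! h
    nlinarith [sq_nonneg R, mul_pos (neg_pos.2 h) (pow_pos hN 2)]
  calc _ = κ * N ^ 2 / 2 * (π * s * E * N / 32) * (k * S) := by ring
      _ ≤ κ * N ^ 2 / 2 * (π * s * E * N / 32 * (8 * N * s)) * (A * M ^ 2 / L) := by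
          gcongr
          exact le_mul_of_one_le_right (by positivity) hsN
      _ = 8 * π * (κ * N ^ 2 / 2) * (A * M) * (1 / (2 * π * L)) *
          (M * (π * s ^ 2 * (E * N ^ 2 / 2) / 8)) := by
          field_simp
          ring
      _ = _ := by rw [← hA, ← hR]; ring

set_option maxHeartbeats 800000 in
theorem exists_le_norm_fderiv_fC_wS (a : ℝ) (ha : 0 ≤ a) : ∃ c : ℝ, 0 < c ∧ ∃ L₀ : ℝ,
    ∀ N : ℕ, L₀ ≤ Real.log N → ∀ (t : ℝ) (x : Plane), 0 ≤ t → t * (N : ℝ) ^ 2 ≤ 1 →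
      1 / (8 * N) ≤ ‖x‖ → ‖x‖ * N ≤ 1 →
      c * √(Real.log N) * (N : ℝ) ^ 3 ≤ ‖fderiv ℝ (fun y => fC (wS a N t y)) x‖ := by
  set κ := Real.exp (-4 * a - 2) with hκ
  refine ⟨κ * (√(2 * π) / (4 * (2 * π) ^ 2)) * π * Real.exp (-2 * a) / 64, by positivity, 4 * a + 4,
    fun N hN t x ht htN hx hxN => ?_⟩
  have hL : 0 < Real.log N := by linarith
  have hNpos : (0 : ℝ) < N := by
    rcases Nat.eq_zero_or_pos N with h | h
    · simp [h] at hL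
    · exact_mod_cast h
  set L := Real.log N with hLdef
  set R := Real.exp (-a) * N with hRdef
  have hlogR : Real.log R = L - a := log_exp_neg_mul hL
  have hexpL : Real.exp L = N := Real.exp_log hNpos
  have hRN : R ≤ N := mul_le_of_le_one_left hNpos.le (Real.exp_le_one_iff.2 (by linarith))
  have hRexp : R = Real.exp (L - a) := by rw [← hlogR, Real.exp_log (by positivity)]
  have hR2 : 2 ≤ R := by
    rw [hRexp]; have := Real.add_one_le_exp (L - a); linarith
  have hx0 : 0 < ‖x‖ := lt_of_lt_of_le (by positivity) hx
  have htR : t * R ^ 2 ≤ 1 := le_trans (by gcongr) htN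
  have hxR : R * ‖x‖ ≤ 1 := by
    rw [mul_comm]; exact le_trans (by gcongr) hxN
  set M := L - a - 1 / 2 with hM
  have hML : L / 2 ≤ M := by linarith
  have hM0 : 0 < M := by linarith
  have hamp : amplitude N ^ 2 * (2 * π) ^ 2 = 1 / (2 * π * L) := amplitude_sq hL
  have hKpos : 0 < amplitude N := by unfold amplitude; positivity
  obtain ⟨T, hT, hTe⟩ := hasFDerivAt_profile R t x
  have hw : HasFDerivAt (wS a N t) (amplitude N • T) x := by
    rw [wS_eq]; exact hT.fun_const_smul _
  have hprof : 2 * π * M ≤ ‖profile R t x‖ := by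
    refine le_trans ?_ ((profile_re_ge (by linarith) ht htR hxR).trans (Complex.re_le_norm _))
    rw [hlogR, hM]; linarith
  have hwM : amplitude N * (2 * π * M) ≤ ‖wS a N t x‖ := by
    rw [wS_eq, norm_smul, Real.norm_of_nonneg hKpos.le]
    exact mul_le_mul_of_nonneg_left hprof hKpos.le
  have hw0 : wS a N t x ≠ 0 := by
    rw [← norm_pos_iff]; exact lt_of_lt_of_le (by positivity) hwM
  have hexp : κ * (N : ℝ) ^ 2 / 2 ≤ Real.exp (4 * π * ‖wS a N t x‖ ^ 2) - 1 := by
    have h1 : 2 * L + (-4 * a - 2) ≤ 4 * π * ‖wS a N t x‖ ^ 2 := by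
      calc 2 * L + (-4 * a - 2) ≤ 2 * M ^ 2 / L := by
            rw [le_div_iff₀ hL, hM]; nlinarith [sq_nonneg (a + 1 / 2)]
        _ = 4 * π * (amplitude N ^ 2 * (2 * π) ^ 2) * M ^ 2 := by
            rw [hamp]; field_simp; ring
        _ = 4 * π * (amplitude N * (2 * π * M)) ^ 2 := by ring
        _ ≤ _ := by gcongr
    have h2 : κ * (N : ℝ) ^ 2 = Real.exp (2 * L + (-4 * a - 2)) := by
      rw [← hexpL, Real.exp_add, ← Real.exp_nat_mul, mul_comm, Nat.cast_ofNat]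
    have h3 : 2 ≤ κ * (N : ℝ) ^ 2 := by
      rw [h2]; have := Real.add_one_le_exp (2 * L + (-4 * a - 2)); linarith
    have h4 : κ * (N : ℝ) ^ 2 ≤ Real.exp (4 * π * ‖wS a N t x‖ ^ 2) := by
      rw [h2]; gcongr
    linarith
  have hinner : amplitude N ^ 2 * (2 * π * M * (π * ‖x‖ ^ 2 * (R ^ 2 / 2) / 8)) ≤
      -⟪wS a N t x, (amplitude N • T) x⟫ := by
    have h := inner_profile_profileDeriv_le (by linarith) (by rw [hlogR]; linarith) ht htR hxR
    rw [wS_eq, smul_apply, hTe, real_inner_smul_left, real_inner_smul_right]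
    have h2 : 2 * π * M * (π * ‖x‖ ^ 2 * (R ^ 2 / 2) / 8) ≤
        -⟪profile R t x, profileDeriv R t x x⟫ := by
      have h3 : R ^ 2 / 2 ≤ R ^ 2 - 1 := by nlinarith
      calc _ ≤ 2 * π * M * (π * ‖x‖ ^ 2 * (R ^ 2 - 1) / 8) := by gcongr
        _ = (2 * π * Real.log R - π) * (π * ‖x‖ ^ 2 * (R ^ 2 - 1) / 8) := by
          rw [hlogR, hM]; ring
        _ ≤ _ := by linarith
    calc _ ≤ amplitude N ^ 2 * -⟪profile R t x, profileDeriv R t x x⟫ := by gcongr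
      _ = _ := by ring
  have hmain := le_norm_fderiv_fC_comp hw hw0 x
  have hKM : √(2 * π) / (4 * (2 * π) ^ 2) * √L ≤ amplitude N * M ^ 2 / L := by
    have h1 : amplitude N = √(2 * π) / √L * ((2 * π) ^ 2)⁻¹ := by
      rw [amplitude, Real.sqrt_div (by positivity), zpow_neg]; norm_cast
    have h2 : L ^ 2 / 4 ≤ M ^ 2 := by nlinarith
    have h3 : 0 < √L := Real.sqrt_pos.2 hL
    have h4 : √L ^ 2 = L := Real.sq_sqrt hL.le
    calc √(2 * π) / (4 * (2 * π) ^ 2) * √L = amplitude N * (L ^ 2 / 4) / L := by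
          rw [h1]
          field_simp
          linear_combination h4
      _ ≤ _ := by gcongr
  have hfin : κ * (√(2 * π) / (4 * (2 * π) ^ 2)) * π * Real.exp (-2 * a) / 64 * √L *
      (N : ℝ) ^ 3 * ‖x‖ ≤ ‖fderiv ℝ (fun y => fC (wS a N t y)) x‖ * ‖x‖ := by
    refine le_trans ?_ hmain
    have hR_sq : R ^ 2 = Real.exp (-2 * a) * (N : ℝ) ^ 2 := by
      rw [hRdef, mul_pow, ← Real.exp_nat_mul]; push_cast; ring_nf
    have hxinv : 1 ≤ 8 * N * ‖x‖ := by
      rwa [div_le_iff₀' (by positivity)] at hx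
    refine (gradient_lower_bound_arith (Real.exp_nonneg _) hL hNpos hx0.le (by positivity) hamp
      hR_sq hxinv
      hKM).trans ?_
    have hexp0 := le_trans (by positivity) hexp
    have h1 := mul_le_mul (mul_le_mul_of_nonneg_left hexp (by positivity : 0 ≤ 8 * π)) hwM
      (by positivity) (mul_nonneg (by positivity) hexp0)
    exact mul_le_mul h1 hinner (by positivity)
      (mul_nonneg (mul_nonneg (by positivity) hexp0) (norm_nonneg _))
  exact le_of_mul_le_mul_right hfin hx0

theorem ofReal_mul_rpow_le_eLpNorm {α E : Type*} [MeasurableSpace α] [NormedAddCommGroup E]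
    {μ : Measure α} {g : α → E} {m ν : ℝ} {p : ℝ≥0∞} (hp : p ≠ 0) (hν : 0 < ν)
    (hm : 0 ≤ m) (hμ : ENNReal.ofReal ν ≤ μ Set.univ) (hg : ∀ᵐ x ∂μ, m ≤ ‖g x‖) :
    ENNReal.ofReal (m * ν ^ (1 / p.toReal)) ≤ eLpNorm g p μ := by
  have hμ0 : μ ≠ 0 := by
    rintro rfl
    simp only [Measure.coe_zero, Pi.zero_apply, nonpos_iff_eq_zero, ENNReal.ofReal_eq_zero] at hμ
    linarith
  calc ENNReal.ofReal (m * ν ^ (1 / p.toReal))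
      = ENNReal.ofReal m * ENNReal.ofReal ν ^ (1 / p.toReal) := by
        rw [ENNReal.ofReal_mul hm, ENNReal.ofReal_rpow_of_pos hν]
    _ ≤ ENNReal.ofReal m * μ Set.univ ^ (1 / p.toReal) := by gcongr
    _ = eLpNorm (fun _ => m) p μ := by
        rw [eLpNorm_const m hp hμ0, Real.enorm_of_nonneg hm]
    _ ≤ eLpNorm g p μ := by
        refine eLpNorm_mono_ae (hg.mono fun x hx => ?_)
        rwa [Real.norm_of_nonneg hm]

theorem one_div_toReal_add {p q : ℝ≥0∞} (hp : 1 ≤ p) (hq : 1 ≤ q)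
    (h : 1 / p + 1 / q = 3 / 2) : 1 / q.toReal + 1 / p.toReal = 3 / 2 := by
  have h1 : ∀ r : ℝ≥0∞, 1 ≤ r → 1 / r ≠ ∞ := fun r hr => by
    rw [one_div]; exact ENNReal.inv_ne_top.2 (one_pos.trans_le hr).ne'
  have := congrArg ENNReal.toReal h
  rw [ENNReal.toReal_add (h1 p hp) (h1 q hq)] at this
  simp only [ENNReal.toReal_div, ENNReal.toReal_one, ENNReal.toReal_ofNat] at this
  linarith

theorem ofReal_le_volume_ring {N : ℝ} (hN : 0 < N) : ENNReal.ofReal ((16 * N) ^ (-2 : ℝ)) ≤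
    volume {x : Plane | 1 / 2 / (4 * N) ≤ ‖x‖ ∧ ‖x‖ ≤ 1 / 2 / (2 * N)} := by
  set c : Plane := EuclideanSpace.single 0 (3 * (16 * N)⁻¹) with hc
  have hcn : ‖c‖ = 3 * (16 * N)⁻¹ := by
    rw [hc, PiLp.norm_single, Real.norm_of_nonneg (by positivity)]
  have h1 : 1 / 2 / (4 * N) = 2 * (16 * N)⁻¹ := by field_simp; norm_num
  have h2 : 1 / 2 / (2 * N) = 4 * (16 * N)⁻¹ := by field_simp; norm_num
  calc ENNReal.ofReal ((16 * N) ^ (-2 : ℝ)) ≤ volume (Metric.ball c (16 * N)⁻¹) := by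
        rw [EuclideanSpace.volume_ball_fin_two, ← ENNReal.ofReal_pow (by positivity),
          ← ENNReal.ofReal_mul (by positivity)]
        refine ENNReal.ofReal_le_ofReal ?_
        rw [Real.rpow_neg (by positivity), inv_pow]
        norm_cast
        exact le_mul_of_one_le_right (by positivity) (by linarith [Real.pi_gt_three])
    _ ≤ _ := by
        refine measure_mono fun x hx => ?_
        rw [Metric.mem_ball, dist_eq_norm] at hx
        have h3 := norm_sub_norm_le c x
        have h4 := norm_sub_norm_le x c
        rw [norm_sub_rev] at h3
        rw [Set.mem_ofPred_eq, h1, h2]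
        constructor <;> linarith

theorem ofReal_le_volume_time_interval {N : ℝ} (hN : 0 < N) :
    ENNReal.ofReal ((16 * N) ^ (-2 : ℝ)) ≤
      volume (Set.Icc ((1 / 2 : ℝ) ^ 2 / (4 * N ^ 2)) ((1 / 2 : ℝ) ^ 2 / (2 * N ^ 2))) := by
  rw [Real.volume_Icc]
  refine ENNReal.ofReal_le_ofReal ?_
  rw [Real.rpow_neg (by positivity)]
  norm_cast
  rw [inv_le_iff_one_le_mul₀ (by positivity)]
  field_simp
  norm_num

theorem spacetime_gradient_lower_bound (a : ℝ) (ha : 0 ≤ a) : ∃ c : ℝ, 0 < c ∧ ∃ L₀ : ℝ,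
    ∀ N : ℕ, L₀ ≤ Real.log N → ∀ p q : ℝ≥0∞, 1 ≤ p → 1 ≤ q → 1 / p + 1 / q = 3 / 2 →
      ENNReal.ofReal (c * √(Real.log N)) ≤
        eLpNorm (fun t : ℝ =>
            (eLpNorm
              (fun x : Plane => ‖fderiv ℝ (fun y => fC (wS a N t y)) x‖) q
              (volume.restrict
                {x : Plane | (1 / 2 : ℝ) / (4 * N) ≤ ‖x‖ ∧ ‖x‖ ≤ (1 / 2 : ℝ) / (2 * N)})).toReal)
          p (volume.restrict
              (Set.Icc ((1 / 2 : ℝ) ^ 2 / (4 * (N : ℝ) ^ 2))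
                ((1 / 2 : ℝ) ^ 2 / (2 * (N : ℝ) ^ 2)))) := by
  obtain ⟨c, hc, L₀, hlow⟩ := exists_le_norm_fderiv_fC_wS a ha
  refine ⟨c / 16 ^ 3, by positivity, max L₀ (a + 1), fun N hN p q hp hq hpq => ?_⟩
  have hL : 0 < Real.log N := by linarith [(le_max_right _ _).trans hN]
  have hNpos : (0 : ℝ) < N := by
    rcases Nat.eq_zero_or_pos N with h | h
    · simp [h] at hL
    · exact_mod_cast h
  have hR : 1 ≤ Real.exp (-a) * N := by
    rw [← Real.exp_log hNpos, ← Real.exp_add]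
    exact Real.one_le_exp (by linarith [(le_max_right _ _).trans hN])
  have hp0 : p ≠ 0 := (one_pos.trans_le hp).ne'
  have hq0 : q ≠ 0 := (one_pos.trans_le hq).ne'
  set A : Set Plane := {x | (1 / 2 : ℝ) / (4 * N) ≤ ‖x‖ ∧ ‖x‖ ≤ (1 / 2 : ℝ) / (2 * N)}
    with hA_def
  set I : Set ℝ := Set.Icc ((1 / 2 : ℝ) ^ 2 / (4 * (N:ℝ) ^ 2)) ((1 / 2 : ℝ) ^ 2 / (2 * (N:ℝ) ^ 2))
    with hI_def
  set ν : ℝ := (16 * N) ^ (-2 : ℝ)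
  have hν : 0 < ν := by positivity
  set m : ℝ := c * √(Real.log N) * (N : ℝ) ^ 3
  have hm : 0 ≤ m := by positivity
  have hA : MeasurableSet A :=
    (measurableSet_le measurable_const measurable_norm).inter
      (measurableSet_le measurable_norm measurable_const)
  have hfin : IsFiniteMeasure (volume.restrict A) := by
    refine ⟨?_⟩
    rw [Measure.restrict_apply_univ]
    refine (measure_mono fun x hx => ?_).trans_lt
      (measure_closedBall_lt_top (x := (0 : Plane)) (r := (1 / 2 : ℝ) / (2 * N)))
    simpa using hx.2
  have hinner : ∀ t ∈ I, m * ν ^ (1 / q.toReal) ≤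
      (eLpNorm (fun x : Plane => ‖fderiv ℝ (fun y => fC (wS a N t y)) x‖) q
        (volume.restrict A)).toReal := by
    intro t ht
    obtain ⟨M, hM⟩ := exists_norm_fderiv_fC_wS_le hR t
    have htop : eLpNorm (fun x : Plane => ‖fderiv ℝ (fun y => fC (wS a N t y)) x‖) q
        (volume.restrict A) ≠ ∞ := by
      refine ne_top_of_le_ne_top ?_
        (eLpNorm_le_of_ae_bound (C := M) (.of_forall fun x => by rw [norm_norm]; exact hM x))
      exact ENNReal.mul_ne_top (ENNReal.rpow_ne_top_of_nonneg (by positivity)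
        (measure_ne_top _ _)) ENNReal.ofReal_ne_top
    rw [← ENNReal.ofReal_le_iff_le_toReal htop]
    refine ofReal_mul_rpow_le_eLpNorm hq0 hν hm ?_ ?_
    · rw [Measure.restrict_apply_univ]; exact ofReal_le_volume_ring hNpos
    · filter_upwards [ae_restrict_mem hA] with x hx
      rw [norm_norm]
      have ht0 : 0 ≤ t := le_trans (by positivity) ht.1
      refine hlow N ((le_max_left _ _).trans hN) t x ht0 ?_ ?_ ?_
      · have := ht.2
        rw [le_div_iff₀ (by positivity)] at this
        linarith
      · refine le_of_eq_of_le ?_ hx.1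
        field_simp; norm_num
      · have := hx.2
        rw [le_div_iff₀ (by positivity)] at this
        linarith
  refine le_of_eq_of_le ?_ (ofReal_mul_rpow_le_eLpNorm (m := m * ν ^ (1 / q.toReal)) hp0 hν
    (by positivity) ?_ ?_)
  · congr 1
    have hpow : ν ^ (1 / q.toReal) * ν ^ (1 / p.toReal) = ((16 * (N : ℝ)) ^ 3)⁻¹ := by
      rw [← Real.rpow_add hν, one_div_toReal_add hp hq hpq, ← Real.rpow_mul (by positivity)]
      norm_num
    rw [mul_assoc m, hpow]
    simp only [m]
    field_simp
  · rw [Measure.restrict_apply_univ]; exact ofReal_le_volume_time_interval hNpos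
  · filter_upwards [ae_restrict_mem measurableSet_Icc] with t ht
    rw [Real.norm_of_nonneg ENNReal.toReal_nonneg]
    exact hinner t ht

/-- criticality of the nonlinear estimate for NLS (Proposition 8.4). -/
theorem statement18 (δ : ℝ) (hδ : 0 < δ) :
    ∃ a : ℝ, 1/2 < a ∧ ∃ ε ∈ Set.Ioo (0:ℝ) 1, ∃ c : ℝ, 0 < c ∧ ∃ N₀ : ℕ,
      ∀ N : ℕ, N₀ ≤ N →
        ((∫ x : Plane, gradNormC (wS a N 0) x ^ 2) +
            (∫ x : Plane, ‖wS a N 0 x‖ ^ 2) < 1) ∧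
        ((∫ x : Plane, gradNormC (wS a N 0) x ^ 2) +
            (∫ x : Plane, 2 * FC (wS a N 0 x)) ≤ 1 + δ) ∧
        (∀ p q : ℝ≥0∞, 1 ≤ p → 1 ≤ q → 1 / p + 1 / q = 3 / 2 →
          ENNReal.ofReal (c * Real.sqrt (Real.log N)) ≤
            eLpNorm (fun t : ℝ =>
                (eLpNorm
                  (fun x : Plane => ‖fderiv ℝ (fun y => fC (wS a N t y)) x‖) q
                  (volume.restrict
                    {x : Plane | ε / (4 * N) ≤ ‖x‖ ∧ ‖x‖ ≤ ε / (2 * N)})).toReal)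
              p (volume.restrict
                  (Set.Icc (ε ^ 2 / (4 * (N:ℝ) ^ 2)) (ε ^ 2 / (2 * (N:ℝ) ^ 2))))) := by
  obtain ⟨a, ha, L₁, hF⟩ := exists_integral_FC_wS_le δ hδ
  obtain ⟨c, hc, L₂, hlow⟩ := spacetime_gradient_lower_bound a (by linarith)
  refine ⟨a, ha, 1 / 2, ⟨by norm_num, by norm_num⟩, c, hc,
    ⌈Real.exp (max (max L₁ L₂) (a + 1))⌉₊, fun N hN => ?_⟩
  have hexp : Real.exp (max (max L₁ L₂) (a + 1)) ≤ N := Nat.ceil_le.1 hN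
  have hNpos : (0 : ℝ) < N := (Real.exp_pos _).trans_le hexp
  have hlog := (Real.le_log_iff_exp_le hNpos).2 hexp
  simp only [max_le_iff] at hlog
  obtain ⟨⟨h₁, h₂⟩, h₃⟩ := hlog
  have hL : 0 < Real.log N := by linarith
  have hR : 1 ≤ Real.exp (-a) * N := by
    rw [← Real.exp_log hNpos, ← Real.exp_add]
    exact Real.one_le_exp (by linarith)
  refine ⟨energy_wS_lt_one ha hL hR, ?_, hlow N h₂⟩
  have hgrad := integral_gradNormC_wS_sq_le hL hR
  have : 0 < a / Real.log N := div_pos (by linarith) hL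
  linarith [hF N h₁]
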